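/- arXiv:2310.13983 — 4 statements merged into one kernel-verified Lean document; each statement's English description precedes it below -/
import Mathlib

section
/- Assume (Q1). Then for every continuous function f : Δ_{d−1} → ℝ, lim_{n→∞} ‖B_{d,n}^{(q_n)} f − f‖_∞ = 0. -/
open Finset Filter MeasureTheory

noncomputable section

/-- Multi-indices `k : Fin d → ℕ` with `|k| = k₁ + ⋯ + k_d = n`. -/
def multiIdx (d n : ℕ) : Finset (Fin d → ℕ) :=
  (Fintype.piFinset fun _ : Fin d => Finset.range (n + 1)).filter fun k => ∑ i, k i = n

/-- Multinomial weight `n!/(k₁!⋯k_d!) · x₁^{k₁}⋯x_d^{k_d}`. -/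
def mWeight {d : ℕ} (x : Fin d → ℝ) (k : Fin d → ℕ) : ℝ :=
  (Nat.multinomial Finset.univ k : ℝ) * ∏ i, x i ^ k i

/-- The `d`-dimensional Bernstein operator `B_{d,n}`. -/
def bernsteinOp (d n : ℕ) (f : (Fin d → ℝ) → ℝ) (x : Fin d → ℝ) : ℝ :=
  ∑ k ∈ multiIdx d n, mWeight x k * f fun i => (k i : ℝ) / n

open Polynomial in
lemma aux_poly {d n : ℕ} (y : Fin d → ℝ) (hy : ∑ i, y i = 1) (i : Fin d) :
    (C (1 - y i) + C (y i) * X : ℝ[X]) ^ n = ∑ k ∈ multiIdx d n, C (mWeight y k) * X ^ (k i) := by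
  have hidx : multiIdx d n = Finset.piAntidiag Finset.univ n := by
    ext k
    simp only [multiIdx, Finset.mem_filter, Fintype.mem_piFinset, Finset.mem_range,
      Finset.mem_piAntidiag, Finset.mem_univ, implies_true, and_true, and_iff_right_iff_imp]
    intro h j
    have := Finset.single_le_sum (f := k) (fun a _ => Nat.zero_le _) (Finset.mem_univ j)
    omega
  have h := Finset.sum_pow_eq_sum_piAntidiag (Finset.univ : Finset (Fin d))
    (fun j => if j = i then (C (y j) * X : ℝ[X]) else C (y j)) n
  have h1 : ∑ j, (if j = i then (C (y j) * X : ℝ[X]) else C (y j)) = C (1 - y i) + C (y i) * X := by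
    rw [← Finset.add_sum_erase _ _ (Finset.mem_univ i)]
    have : ∑ j ∈ Finset.univ.erase i, (if j = i then (C (y j) * X : ℝ[X]) else C (y j))
        = C (1 - y i) := by
      rw [← hy, ← Finset.add_sum_erase _ _ (Finset.mem_univ i), add_sub_cancel_left, map_sum]
      refine Finset.sum_congr rfl fun j hj => ?_
      rw [if_neg (Finset.ne_of_mem_erase hj)]
    rw [this, if_pos rfl, add_comm]
  rw [h1] at h
  rw [h, hidx]
  refine Finset.sum_congr rfl fun k _ => ?_
  have h2 : ∀ j, (if j = i then (C (y j) * X : ℝ[X]) else C (y j)) ^ k j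
      = C (y j ^ k j) * (if j = i then X ^ k j else 1) := by
    intro j
    split_ifs <;> simp [mul_pow]
  simp only [h2, Finset.prod_mul_distrib, Finset.prod_ite_eq', Finset.mem_univ, if_true, mWeight,
    map_mul, map_prod, map_natCast, mul_assoc]

lemma aux_m0 {d n : ℕ} (y : Fin d → ℝ) (hy : ∑ i, y i = 1) (i : Fin d) :
    ∑ k ∈ multiIdx d n, mWeight y k = 1 := by
  have := congrArg (Polynomial.eval 1) (aux_poly (n := n) y hy i)
  simp [Polynomial.eval_finsetSum] at this
  exact this.symm

lemma aux_m1 {d n : ℕ} (y : Fin d → ℝ) (hy : ∑ i, y i = 1) (i : Fin d) :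
    ∑ k ∈ multiIdx d n, mWeight y k * (k i : ℝ) = n * y i := by
  have := congrArg (fun p => Polynomial.eval 1 (Polynomial.derivative p)) (aux_poly (n := n) y hy i)
  simp [Polynomial.eval_finsetSum, Polynomial.derivative_pow] at this
  exact this.symm

lemma aux_m2 {d n : ℕ} (y : Fin d → ℝ) (hy : ∑ i, y i = 1) (i : Fin d) :
    ∑ k ∈ multiIdx d n, mWeight y k * ((k i : ℝ) * ((k i : ℝ) - 1)) = n * (n - 1) * y i ^ 2 := by
  have := congrArg (fun p => Polynomial.eval 1 (Polynomial.derivative (Polynomial.derivative p)))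
    (aux_poly (n := n) y hy i)
  have hc : ∀ m : ℕ, (m : ℝ) * ((m - 1 : ℕ) : ℝ) = m * (m - 1) := by
    intro m
    cases m <;> simp
  simp [Polynomial.eval_finsetSum, Polynomial.derivative_pow, hc] at this
  rw [← this, ← hc]
  ring

lemma aux_var {d n : ℕ} (hn : 1 ≤ n) (y : Fin d → ℝ) (hy : ∑ i, y i = 1) (i : Fin d) :
    ∑ k ∈ multiIdx d n, mWeight y k * ((k i : ℝ) / n - y i) ^ 2 = y i * (1 - y i) / n := by
  have hn' : (n : ℝ) ≠ 0 := by positivity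
  have e : ∀ k ∈ multiIdx d n, mWeight y k * ((k i : ℝ) / n - y i) ^ 2
      = (1 / (n : ℝ) ^ 2) * (mWeight y k * ((k i : ℝ) * ((k i : ℝ) - 1)))
        + (1 / (n : ℝ) ^ 2 - 2 * y i / n) * (mWeight y k * (k i : ℝ)) + y i ^ 2 * mWeight y k := by
    intro k _
    field_simp
    ring
  rw [Finset.sum_congr rfl e, Finset.sum_add_distrib, Finset.sum_add_distrib, ← Finset.mul_sum,
    ← Finset.mul_sum, ← Finset.mul_sum, aux_m0 y hy i, aux_m1 y hy i, aux_m2 y hy i]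
  field_simp
  ring

lemma aux_osc {d : ℕ} (f : (Fin d → ℝ) → ℝ) (hf : ContinuousOn f (stdSimplex ℝ (Fin d)))
    (ε : ℝ) (hε : 0 < ε) : ∃ K : ℝ, 0 ≤ K ∧ ∀ a ∈ stdSimplex ℝ (Fin d),
      ∀ b ∈ stdSimplex ℝ (Fin d), |f a - f b| ≤ ε + K * ∑ i, (a i - b i) ^ 2 := by
  have hc : IsCompact (stdSimplex ℝ (Fin d)) := isCompact_stdSimplex ..
  obtain ⟨M, hM⟩ := hc.exists_bound_of_continuousOn hf
  obtain ⟨δ, hδ, hu⟩ := Metric.uniformContinuousOn_iff.1 (hc.uniformContinuousOn_of_continuous hf) ε hε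
  refine ⟨2 * |M| / δ ^ 2, by positivity, fun a ha b hb => ?_⟩
  have hs : 0 ≤ ∑ i, (a i - b i) ^ 2 := Finset.sum_nonneg fun i _ => sq_nonneg _
  by_cases h : dist a b < δ
  · have := (hu a ha b hb h).le
    rw [Real.dist_eq] at this
    have : 0 ≤ 2 * |M| / δ ^ 2 * ∑ i, (a i - b i) ^ 2 := by positivity
    linarith
  · have h1 : δ ^ 2 ≤ ∑ i, (a i - b i) ^ 2 := by
      rw [dist_pi_lt_iff hδ] at h
      push Not at h
      obtain ⟨i, hi⟩ := h
      rw [Real.dist_eq] at hi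
      calc δ ^ 2 ≤ |a i - b i| ^ 2 := by gcongr
        _ = (a i - b i) ^ 2 := sq_abs _
        _ ≤ _ := Finset.single_le_sum (f := fun i => (a i - b i) ^ 2)
          (fun i _ => sq_nonneg _) (Finset.mem_univ i)
    have h2 : |f a - f b| ≤ 2 * |M| := by
      have ha' := (hM a ha).trans (le_abs_self M)
      have hb' := (hM b hb).trans (le_abs_self M)
      rw [Real.norm_eq_abs] at ha' hb'
      have := abs_sub (f a) (f b)
      linarith
    have h3 : 2 * |M| ≤ 2 * |M| / δ ^ 2 * ∑ i, (a i - b i) ^ 2 := by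
      calc 2 * |M| = 2 * |M| / δ ^ 2 * δ ^ 2 := by field_simp
        _ ≤ _ := by gcongr
    linarith

lemma aux_main {d n : ℕ} (hd : 2 ≤ d) (hn : 1 ≤ n) (f : (Fin d → ℝ) → ℝ) (ε K : ℝ) (hK0 : 0 ≤ K)
    (hK : ∀ a ∈ stdSimplex ℝ (Fin d),
      ∀ b ∈ stdSimplex ℝ (Fin d), |f a - f b| ≤ ε + K * ∑ i, (a i - b i) ^ 2)
    (x y : Fin d → ℝ) (hx : x ∈ stdSimplex ℝ (Fin d)) (hy : y ∈ stdSimplex ℝ (Fin d)) :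
    |bernsteinOp d n f y - f x| ≤ ε + K * (2 * d / n + 2 * ∑ i, (y i - x i) ^ 2) := by
  have hn' : (n : ℝ) ≠ 0 := by positivity
  have hw : ∀ k, 0 ≤ mWeight y k := fun k =>
    mul_nonneg (Nat.cast_nonneg _) (Finset.prod_nonneg fun i _ => pow_nonneg (hy.1 i) _)
  have h0 : ∑ k ∈ multiIdx d n, mWeight y k = 1 := aux_m0 y hy.2 ⟨0, by omega⟩
  have hks : ∀ k ∈ multiIdx d n, (fun i => (k i : ℝ) / n) ∈ stdSimplex ℝ (Fin d) := by
    intro k hk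
    refine ⟨fun i => by positivity, ?_⟩
    have : ∑ i, k i = n := (Finset.mem_filter.1 hk).2
    rw [← Finset.sum_div, ← Nat.cast_sum, this, div_self hn']
  have e : bernsteinOp d n f y - f x
      = ∑ k ∈ multiIdx d n, mWeight y k * (f (fun i => (k i : ℝ) / n) - f x) := by
    simp only [mul_sub, Finset.sum_sub_distrib, ← Finset.sum_mul, h0, one_mul, bernsteinOp]
  rw [e]
  calc _ ≤ ∑ k ∈ multiIdx d n, mWeight y k * (ε + K * ∑ i,
          (2 * ((k i : ℝ) / n - y i) ^ 2 + 2 * (y i - x i) ^ 2)) := by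
        refine (Finset.abs_sum_le_sum_abs _ _).trans (Finset.sum_le_sum fun k hk => ?_)
        rw [abs_mul, abs_of_nonneg (hw k)]
        refine mul_le_mul_of_nonneg_left ((hK _ (hks k hk) x hx).trans ?_) (hw k)
        gcongr with i
        nlinarith [sq_nonneg (((k i : ℝ) / n - y i) - (y i - x i))]
    _ = ε + K * (2 * ∑ i, ∑ k ∈ multiIdx d n, mWeight y k * ((k i : ℝ) / n - y i) ^ 2
          + 2 * ∑ i, (y i - x i) ^ 2) := by
        rw [Finset.sum_comm]
        simp only [Finset.sum_add_distrib, mul_add, ← Finset.mul_sum, ← Finset.sum_mul, h0, one_mul]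
        congr 2
        simp only [Finset.mul_sum]
        refine Finset.sum_congr rfl fun k _ => Finset.sum_congr rfl fun i _ => ?_
        ring
    _ ≤ _ := by
        gcongr
        rw [mul_div_assoc]
        gcongr
        calc _ ≤ ∑ i : Fin d, 1 / (n : ℝ) := by
              refine Finset.sum_le_sum fun i _ => ?_
              rw [aux_var hn y hy.2 i]
              gcongr
              nlinarith [sq_nonneg (y i - 1), hy.1 i, sq_nonneg (y i)]
          _ = _ := by simp [div_eq_mul_inv]

/-- under Assumption (Q1), the Bernstein operators associated with `q_n`
uniformly approximate every continuous function on the simplex: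
`lim_{n→∞} ‖B_{d,n}^{(q_n)} f − f‖_∞ = 0`.  Here
`B_{d,n}^{(q_n)} f (x) = B_{d,n} f (x^{(q_n)})` with
`x_i^{(q_n)} = x_i + ∑_j q_{ji}^{(n)} x_j`. -/
theorem bernstein_mutation_uniform_approx (d : ℕ) (hd : 2 ≤ d)
    (q : ℕ → Fin d → Fin d → ℝ)
    (hqpos : ∀ n, 1 ≤ n → ∀ i j, i ≠ j → 0 < q n i j)
    (hqdiag : ∀ n, 1 ≤ n → ∀ i, q n i i = -∑ j ∈ Finset.univ.erase i, q n i j)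
    (hqsimplex : ∀ n, 1 ≤ n → ∀ x ∈ stdSimplex ℝ (Fin d),
      (fun i => x i + ∑ j, q n j i * x j) ∈ stdSimplex ℝ (Fin d))
    -- Assumption (Q1):
    (Q : Fin d → Fin d → ℝ)
    (hQpos : ∀ i j, i ≠ j → 0 < Q i j)
    (hQdiag : ∀ i, Q i i = -∑ j ∈ Finset.univ.erase i, Q i j)
    (C₀ γ : ℝ) (hC₀ : 0 < C₀) (hγ : 1 < γ)
    (hQ1 : ∀ n : ℕ, 1 ≤ n → ∀ i j, |q n i j - Q i j / n| ≤ C₀ * (n : ℝ) ^ (-γ))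
    (f : (Fin d → ℝ) → ℝ) (hf : ContinuousOn f (stdSimplex ℝ (Fin d))) :
    Tendsto (fun n : ℕ => ⨆ x ∈ stdSimplex ℝ (Fin d),
        |bernsteinOp d n f (fun i => x i + ∑ j, q n j i * x j) - f x|)
      atTop (nhds 0) := by
  have hq0 : ∀ i j, Tendsto (fun n => q n i j) atTop (nhds 0) := by
    intro i j
    have t1 : Tendsto (fun n : ℕ => C₀ * (n : ℝ) ^ (-γ)) atTop (nhds 0) := by
      simpa using ((tendsto_rpow_neg_atTop (by linarith : 0 < γ)).comp
        tendsto_natCast_atTop_atTop).const_mul C₀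
    have t2 : Tendsto (fun n : ℕ => q n i j - Q i j / n) atTop (nhds 0) := by
      refine squeeze_zero_norm' ?_ t1
      filter_upwards [eventually_ge_atTop 1] with n hn
      exact hQ1 n hn i j
    simpa using t2.add (tendsto_const_div_atTop_nhds_zero_nat (Q i j))
  have hR : Tendsto (fun n => ∑ i, (∑ j, |q n j i|) ^ 2) atTop (nhds 0) := by
    have : Tendsto (fun n => ∑ i, (∑ j, |q n j i|) ^ 2) atTop
        (nhds (∑ i : Fin d, (∑ j : Fin d, |(0 : ℝ)|) ^ 2)) :=
      tendsto_finsetSum _ fun i _ => (tendsto_finsetSum _ fun j _ => (hq0 j i).abs).pow 2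
    simpa using this
  rw [Metric.tendsto_nhds]
  intro ε hε
  obtain ⟨K, hK0, hK⟩ := aux_osc f hf (ε / 4) (by positivity)
  have hT : Tendsto (fun n : ℕ => K * (2 * (d : ℝ) / n + 2 * ∑ i, (∑ j, |q n j i|) ^ 2)) atTop
      (nhds 0) := by
    simpa using ((tendsto_const_div_atTop_nhds_zero_nat (2 * (d : ℝ))).add
      (hR.const_mul 2)).const_mul K
  filter_upwards [eventually_ge_atTop 1, hT.eventually_lt_const (by positivity : 0 < ε / 4)]
    with n hn hlt
  have hb : ∀ x, (⨆ (_ : x ∈ stdSimplex ℝ (Fin d)),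
      |bernsteinOp d n f (fun i => x i + ∑ j, q n j i * x j) - f x|) ≤ ε / 2 := by
    intro x
    refine Real.iSup_le (fun hx => ?_) (by positivity)
    refine (aux_main hd hn f (ε / 4) K hK0 hK x _ hx (hqsimplex n hn x hx)).trans ?_
    have : ∑ i, ((x i + ∑ j, q n j i * x j) - x i) ^ 2 ≤ ∑ i, (∑ j, |q n j i|) ^ 2 := by
      refine Finset.sum_le_sum fun i _ => ?_
      rw [add_sub_cancel_left, ← sq_abs]
      gcongr
      refine (Finset.abs_sum_le_sum_abs _ _).trans (Finset.sum_le_sum fun j _ => ?_)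
      rw [abs_mul, abs_of_nonneg (hx.1 j)]
      have hx1 : x j ≤ 1 := hx.2 ▸ Finset.single_le_sum (fun a _ => hx.1 a) (Finset.mem_univ j)
      exact mul_le_of_le_one_right (abs_nonneg _) hx1
    have := mul_le_mul_of_nonneg_left (add_le_add_right (mul_le_mul_of_nonneg_left this
      (by norm_num : (0 : ℝ) ≤ 2)) (2 * (d : ℝ) / n)) hK0
    linarith
  rw [Real.dist_eq, sub_zero, abs_of_nonneg
    (Real.iSup_nonneg fun x => Real.iSup_nonneg fun _ => abs_nonneg _)]
  have := Real.iSup_le hb (by positivity)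
  linarith
end
end

section
/- (Voronovskaya-type theorem.) Let f : ℝ^d → ℝ be twice continuously differentiable on an open neighborhood of Δ_{d−1}. Then lim_{n→∞} max_{x ∈ Δ_{d−1}} |n(B_{d,n} f(x) − f(x)) − 𝒜_d f(x)| = 0. -/
open Finset Filter MeasureTheory

noncomputable section

/-- First partial derivative `∂f/∂x_i`. -/
def pd {d : ℕ} (i : Fin d) (f : (Fin d → ℝ) → ℝ) (x : Fin d → ℝ) : ℝ :=
  fderiv ℝ f x (Pi.single i 1)

/-- Second partial derivative `∂²f/∂x_i∂x_j`. -/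
def pd2 {d : ℕ} (i j : Fin d) (f : (Fin d → ℝ) → ℝ) (x : Fin d → ℝ) : ℝ :=
  pd i (pd j f) x

/-- The Wright–Fisher generator
`𝒜_d f(x) = (1/2) Σ_{i,j} x_i(δ_{ij} − x_j) ∂²f/∂x_i∂x_j (x)`. -/
def Ad (d : ℕ) (f : (Fin d → ℝ) → ℝ) (x : Fin d → ℝ) : ℝ :=
  (1 / 2) * ∑ i, ∑ j, x i * ((if i = j then 1 else 0) - x j) * pd2 i j f x


lemma multiIdx_eq (d n : ℕ) : multiIdx d n = Finset.piAntidiag Finset.univ n := by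
  ext k
  simp only [multiIdx, Finset.mem_filter, Fintype.mem_piFinset, Finset.mem_range,
    Finset.mem_piAntidiag, Finset.mem_univ, implies_true, and_true, and_iff_right_iff_imp]
  intro h a
  have := Finset.single_le_sum (f := k) (fun i _ => Nat.zero_le _) (Finset.mem_univ a)
  omega

def vLin {d : ℕ} (g : (Fin d → ℕ) → ℝ) : AddMonoidAlgebra ℝ (Fin d → ℕ) →ₗ[ℝ] ℝ :=
  (Finsupp.linearCombination ℝ g).comp (AddMonoidAlgebra.coeffLinearEquiv ℝ).toLinearMap

lemma vLin_single {d : ℕ} (g : (Fin d → ℕ) → ℝ) (k : Fin d → ℕ) (c : ℝ) :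
    vLin g (AddMonoidAlgebra.single k c) = c * g k := by
  simp [vLin]

def vP {d : ℕ} (x : Fin d → ℝ) : AddMonoidAlgebra ℝ (Fin d → ℕ) :=
  ∑ i, AddMonoidAlgebra.single (Pi.single i 1) (x i)

lemma vP_pow {d : ℕ} (x : Fin d → ℝ) (n : ℕ) :
    vP x ^ n = ∑ k ∈ multiIdx d n, AddMonoidAlgebra.single k (mWeight x k) := by
  rw [vP, Finset.sum_pow_eq_sum_piAntidiag, multiIdx_eq]
  refine Finset.sum_congr rfl fun k _ => ?_
  simp_rw [AddMonoidAlgebra.single_pow, AddMonoidAlgebra.prod_single]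
  rw [AddMonoidAlgebra.natCast_def, AddMonoidAlgebra.single_mul_single, mWeight, zero_add]
  congr 1
  ext j
  simp [Finset.sum_apply, Pi.single_apply]

lemma sum_eq_vLin {d : ℕ} (x : Fin d → ℝ) (n : ℕ) (g : (Fin d → ℕ) → ℝ) :
    ∑ k ∈ multiIdx d n, mWeight x k * g k = vLin g (vP x ^ n) := by
  rw [vP_pow, map_sum]
  simp [vLin_single]

lemma sum_succ {d : ℕ} (x : Fin d → ℝ) (n : ℕ) (g : (Fin d → ℕ) → ℝ) :
    ∑ k ∈ multiIdx d (n+1), mWeight x k * g k =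
      ∑ i, x i * ∑ k ∈ multiIdx d n, mWeight x k * g (k + Pi.single i 1) := by
  rw [sum_eq_vLin, pow_succ, vP_pow, vP, Finset.sum_mul_sum, Finset.sum_comm, map_sum]
  refine Finset.sum_congr rfl fun i _ => ?_
  rw [map_sum, Finset.mul_sum]
  refine Finset.sum_congr rfl fun k _ => ?_
  rw [AddMonoidAlgebra.single_mul_single, vLin_single]
  ring

/-- centered expectation -/
def vW {d : ℕ} (x : Fin d → ℝ) (n : ℕ) (G : (Fin d → ℝ) → ℝ) : ℝ :=
  ∑ k ∈ multiIdx d n, mWeight x k * G (fun i => (k i : ℝ) - n * x i)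

lemma vW_zero {d : ℕ} (x : Fin d → ℝ) (G : (Fin d → ℝ) → ℝ) : vW x 0 G = G 0 := by
  have h : multiIdx d 0 = {0} := by
    rw [multiIdx_eq]; simp
  rw [vW, h, Finset.sum_singleton]
  simp [mWeight, Nat.multinomial, ← Pi.zero_def]

lemma vW_succ {d : ℕ} (x : Fin d → ℝ) (n : ℕ) (G : (Fin d → ℝ) → ℝ) :
    vW x (n+1) G = ∑ i, x i * vW x n (fun s => G (fun j => s j + ((if j = i then 1 else 0) - x j))) := by
  rw [vW, sum_succ x n (fun k => G (fun i => (k i : ℝ) - (n+1 : ℕ) * x i))]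
  simp only [vW]
  refine Finset.sum_congr rfl fun i _ => ?_
  congr 1
  refine Finset.sum_congr rfl fun k _ => ?_
  congr 2
  ext j
  by_cases h : j = i
  · simp [h]; ring
  · simp [h]; ring

lemma vW_add {d : ℕ} (x : Fin d → ℝ) (n : ℕ) (G H : (Fin d → ℝ) → ℝ) :
    vW x n (fun s => G s + H s) = vW x n G + vW x n H := by
  simp [vW, mul_add, Finset.sum_add_distrib]

lemma vW_sub {d : ℕ} (x : Fin d → ℝ) (n : ℕ) (G H : (Fin d → ℝ) → ℝ) :
    vW x n (fun s => G s - H s) = vW x n G - vW x n H := by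
  simp [vW, mul_sub, Finset.sum_sub_distrib]

lemma vW_mul {d : ℕ} (x : Fin d → ℝ) (n : ℕ) (c : ℝ) (G : (Fin d → ℝ) → ℝ) :
    vW x n (fun s => c * G s) = c * vW x n G := by
  simp only [vW, Finset.mul_sum]
  exact Finset.sum_congr rfl fun k _ => by ring

lemma vW_sum {d : ℕ} (x : Fin d → ℝ) (n : ℕ) {ι : Type} (t : Finset ι) (G : ι → (Fin d → ℝ) → ℝ) :
    vW x n (fun s => ∑ a ∈ t, G a s) = ∑ a ∈ t, vW x n (G a) := by
  simp only [vW, Finset.mul_sum]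
  exact Finset.sum_comm

lemma mWeight_nonneg {d : ℕ} {x : Fin d → ℝ} (hx : x ∈ stdSimplex ℝ (Fin d)) (k : Fin d → ℕ) :
    0 ≤ mWeight x k :=
  mul_nonneg (Nat.cast_nonneg _) (Finset.prod_nonneg fun i _ => pow_nonneg (hx.1 i) _)

lemma vW_one {d : ℕ} {x : Fin d → ℝ} (hx : x ∈ stdSimplex ℝ (Fin d)) (n : ℕ) :
    vW x n (fun _ => 1) = 1 := by
  induction n with
  | zero => rw [vW_zero]
  | succ n ih => rw [vW_succ]; simp [ih, hx.2]

lemma vW_const {d : ℕ} {x : Fin d → ℝ} (hx : x ∈ stdSimplex ℝ (Fin d)) (n : ℕ) (c : ℝ) :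
    vW x n (fun _ => c) = c := by
  have := vW_mul x n c (fun _ => 1)
  rw [vW_one hx] at this
  simpa using this

lemma sum_aux {d : ℕ} {x : Fin d → ℝ} (hx : x ∈ stdSimplex ℝ (Fin d)) (a : Fin d) (u v : ℝ) :
    ∑ i, x i * (if a = i then u else v) = x a * u + (1 - x a) * v := by
  have : ∀ i, x i * (if a = i then u else v) = (if a = i then x i * (u - v) else 0) + x i * v := by
    intro i; split_ifs <;> ring
  simp_rw [this, Finset.sum_add_distrib, ← Finset.sum_mul, hx.2]
  simp
  ring

lemma vW_lin {d : ℕ} {x : Fin d → ℝ} (hx : x ∈ stdSimplex ℝ (Fin d)) (n : ℕ) (a : Fin d) :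
    vW x n (fun s => s a) = 0 := by
  induction n with
  | zero => rw [vW_zero]; rfl
  | succ n ih =>
    rw [vW_succ]
    simp_rw [vW_add, ih, vW_const hx, zero_add, mul_sub, Finset.sum_sub_distrib, sum_aux hx,
      ← Finset.sum_mul, hx.2]
    ring

lemma vW_quad {d : ℕ} {x : Fin d → ℝ} (hx : x ∈ stdSimplex ℝ (Fin d)) (n : ℕ) (a b : Fin d) :
    vW x n (fun s => s a * s b) = n * (x a * ((if a = b then 1 else 0) - x b)) := by
  induction n with
  | zero => rw [vW_zero]; simp
  | succ n ih =>
    rw [vW_succ]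
    have : ∀ i, vW x n (fun s => (s a + ((if a = i then 1 else 0) - x a)) *
        (s b + ((if b = i then 1 else 0) - x b))) = n * (x a * ((if a = b then 1 else 0) - x b)) +
        ((if a = i then 1 else 0) - x a) * ((if b = i then 1 else 0) - x b) := by
      intro i
      have : (fun s : Fin d → ℝ => (s a + ((if a = i then 1 else 0) - x a)) *
        (s b + ((if b = i then 1 else 0) - x b))) = fun s =>
        (s a * s b + ((if b = i then 1 else 0) - x b) * s a) + (((if a = i then 1 else 0) - x a) * s b
         + ((if a = i then 1 else 0) - x a) * ((if b = i then 1 else 0) - x b)) := by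
        ext s; ring
      rw [this, vW_add, vW_add, vW_add, vW_mul, vW_mul, vW_const hx, vW_lin hx, vW_lin hx, ih]
      ring
    simp_rw [this]
    have h2 : ∀ i, x i * (n * (x a * ((if a = b then 1 else 0) - x b)) +
        ((if a = i then 1 else 0) - x a) * ((if b = i then 1 else 0) - x b)) =
        x i * (n * (x a * ((if a = b then 1 else 0) - x b)) + x a * x b)
        - x a * (x i * (if b = i then 1 else 0)) - x b * (x i * (if a = i then 1 else 0)) +
        x i * (if a = i then (if a = b then 1 else 0) else 0) := by
      intro i
      by_cases h1 : a = i
      · subst h1; simp only [eq_comm (a := b), if_true]; split_ifs <;> ring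
      · simp only [h1, if_false]; ring
    simp_rw [h2, Finset.sum_add_distrib, Finset.sum_sub_distrib, ← Finset.mul_sum, sum_aux hx,
      ← Finset.sum_mul, hx.2]
    push_cast
    ring

lemma vW_four {d : ℕ} {x : Fin d → ℝ} (hx : x ∈ stdSimplex ℝ (Fin d)) (n : ℕ) (a : Fin d) :
    vW x n (fun s => s a ^ 4) ≤ 3 * (n:ℝ)^2 := by
  have hq : ∀ n, vW x n (fun s => s a ^ 2) = n * (x a * (1 - x a)) := by
    intro n
    have := vW_quad hx n a a
    simpa [← sq] using this
  have h0 := hx.1 a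
  have h1 : x a ≤ 1 := by
    rw [← hx.2]; exact Finset.single_le_sum (fun i _ => hx.1 i) (Finset.mem_univ a)
  induction n with
  | zero => rw [vW_zero]; simp
  | succ n ih =>
    rw [vW_succ]
    have key : ∀ c : ℝ, ∃ m3 : ℝ, vW x n (fun s => (s a + c) ^ 4) =
        vW x n (fun s => s a ^ 4) + 4 * c * vW x n (fun s => s a ^ 3) +
          6 * c^2 * (n * (x a * (1 - x a))) + c^4 := by
      intro c
      refine ⟨0, ?_⟩
      have : (fun s : Fin d → ℝ => (s a + c) ^ 4) = fun s => (s a ^ 4 + (4 * c) * s a ^ 3) +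
          ((6 * c^2) * s a ^ 2 + ((4 * c^3) * s a + c^4)) := by
        ext s; ring
      rw [this, vW_add, vW_add, vW_add, vW_add, vW_mul, vW_mul, vW_mul, vW_const hx, vW_lin hx, hq]
      ring
    have key : ∀ c : ℝ, vW x n (fun s => (s a + c) ^ 4) =
        vW x n (fun s => s a ^ 4) + 4 * c * vW x n (fun s => s a ^ 3) +
          6 * c^2 * (n * (x a * (1 - x a))) + c^4 := fun c => (key c).choose_spec
    simp_rw [key]
    generalize vW x n (fun s => s a ^ 4) = M4 at *
    generalize vW x n (fun s => s a ^ 3) = M3 at *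
    have h2 : ∀ i, x i * (M4 + 4 * ((if a = i then 1 else 0) - x a) * M3 +
          6 * ((if a = i then 1 else 0) - x a)^2 * (n * (x a * (1 - x a))) +
          ((if a = i then 1 else 0) - x a)^4) =
        x i * (if a = i then M4 + 4 * (1 - x a) * M3 + 6 * (1 - x a)^2 * (n * (x a * (1 - x a))) + (1 - x a)^4
          else M4 + 4 * (0 - x a) * M3 + 6 * (0 - x a)^2 * (n * (x a * (1 - x a))) + (0 - x a)^4) := by
      intro i; split_ifs <;> rfl
    simp_rw [h2, sum_aux hx]
    generalize x a = p at *
    have hn : (0:ℝ) ≤ n := Nat.cast_nonneg n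
    have e : p * (M4 + 4 * (1 - p) * M3 + 6 * (1 - p)^2 * (n * (p * (1 - p))) + (1 - p)^4) +
      (1 - p) * (M4 + 4 * (0 - p) * M3 + 6 * (0 - p)^2 * (n * (p * (1 - p))) + (0 - p)^4)
      = M4 + 6 * n * (p * (1-p))^2 + (p * (1-p)) * ((1-p)^3 + p^3) := by ring
    rw [e]
    have b1 : p * (1-p) ≤ 1 := by nlinarith
    have b0 : 0 ≤ p * (1-p) := mul_nonneg h0 (by linarith)
    have b2 : (p * (1-p))^2 ≤ 1 := pow_le_one₀ b0 b1
    have b3 : (1-p)^3 + p^3 ≤ 3 := by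
      have := pow_le_one₀ (n := 3) h0 h1
      have := pow_le_one₀ (n := 3) (a := 1 - p) (by linarith) (by linarith)
      linarith
    have b4 : (p * (1-p)) * ((1-p)^3 + p^3) ≤ 1 * 3 := by
      apply mul_le_mul b1 b3 _ zero_le_one
      have := pow_nonneg h0 3
      have := pow_nonneg (a := 1 - p) (by linarith) 3
      linarith
    have b5 : 6 * n * (p * (1-p))^2 ≤ 6 * n * 1 := by gcongr
    push_cast
    nlinarith

lemma taylor_bound {d : ℕ} (f : (Fin d → ℝ) → ℝ)
    (U : Set (Fin d → ℝ)) (hU : IsOpen U) (hsub : stdSimplex ℝ (Fin d) ⊆ U)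
    (hf : ContDiffOn ℝ 2 f U) (ε : ℝ) (hε : 0 < ε) :
    ∃ C : ℝ, 0 ≤ C ∧ ∀ x ∈ stdSimplex ℝ (Fin d), ∀ y ∈ stdSimplex ℝ (Fin d),
      |f y - f x - fderiv ℝ f x (y - x) - (1/2) * fderiv ℝ (fderiv ℝ f) x (y - x) (y - x)|
        ≤ ε * ‖y - x‖^2 + C * ‖y - x‖^4 := by
  have hf1 : ContDiffOn ℝ 1 (fderiv ℝ f) U := hf.fderiv_of_isOpen hU (by norm_num)
  have hd1 : ∀ z ∈ U, HasFDerivAt f (fderiv ℝ f z) z := fun z hz =>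
    ((hf.differentiableOn (by norm_num)).differentiableAt (hU.mem_nhds hz)).hasFDerivAt
  have hd2 : ∀ z ∈ U, HasFDerivAt (fderiv ℝ f) (fderiv ℝ (fderiv ℝ f) z) z := fun z hz =>
    ((hf1.differentiableOn (by norm_num)).differentiableAt (hU.mem_nhds hz)).hasFDerivAt
  have hc : ContinuousOn (fderiv ℝ (fderiv ℝ f)) (stdSimplex ℝ (Fin d)) :=
    (hf1.continuousOn_fderiv_of_isOpen hU le_rfl).mono hsub
  have hK : IsCompact (stdSimplex ℝ (Fin d)) := isCompact_stdSimplex ℝ (Fin d)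
  obtain ⟨B, hB⟩ := hK.exists_bound_of_continuousOn
    (E := (Fin d → ℝ) →L[ℝ] (Fin d → ℝ) →L[ℝ] ℝ) hc
  have huc : UniformContinuousOn (fderiv ℝ (fderiv ℝ f)) (stdSimplex ℝ (Fin d)) :=
    IsCompact.uniformContinuousOn_of_continuous (β := (Fin d → ℝ) →L[ℝ] (Fin d → ℝ) →L[ℝ] ℝ) hK hc
  replace huc := (Metric.uniformContinuousOn_iff (α := Fin d → ℝ)
    (β := (Fin d → ℝ) →L[ℝ] (Fin d → ℝ) →L[ℝ] ℝ)).1 huc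
  obtain ⟨δ, hδ, huc⟩ := huc ε hε
  refine ⟨2 * |B| / δ^2, by positivity, fun x hx y hy => ?_⟩
  set C := 2 * |B| / δ^2 with hC
  have hC0 : 0 ≤ C := by positivity
  have hosc : ∀ z ∈ stdSimplex ℝ (Fin d),
      ‖fderiv ℝ (fderiv ℝ f) z - fderiv ℝ (fderiv ℝ f) x‖ ≤ ε + C * ‖z - x‖^2 := by
    intro z hz
    by_cases h : dist z x < δ
    · have := (huc z hz x hx h).le
      have h0 : ‖fderiv ℝ (fderiv ℝ f) z - fderiv ℝ (fderiv ℝ f) x‖ ≤ ε :=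
        (dist_eq_norm (fderiv ℝ (fderiv ℝ f) z) (fderiv ℝ (fderiv ℝ f) x)).symm.le.trans this
      have : 0 ≤ C * ‖z - x‖^2 := by positivity
      linarith
    · push Not at h
      rw [dist_eq_norm] at h
      have h1 : ‖fderiv ℝ (fderiv ℝ f) z - fderiv ℝ (fderiv ℝ f) x‖ ≤ 2 * |B| := by
        have := norm_sub_le (fderiv ℝ (fderiv ℝ f) z) (fderiv ℝ (fderiv ℝ f) x)
        have := hB z hz
        have := hB x hx
        have := le_abs_self B
        linarith
      have h2 : 2 * |B| = C * δ^2 := by rw [hC]; field_simp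
      have h3 : C * δ^2 ≤ C * ‖z - x‖^2 := by gcongr
      linarith
  have hseg : segment ℝ x y ⊆ stdSimplex ℝ (Fin d) :=
    (convex_stdSimplex ℝ (Fin d)).segment_subset hx hy
  have hnorm : ∀ z ∈ segment ℝ x y, ‖z - x‖ ≤ ‖y - x‖ := by
    rintro z hz
    rw [segment_eq_image'] at hz
    obtain ⟨t, ht, rfl⟩ := hz
    simp only [add_sub_cancel_left, norm_smul, Real.norm_eq_abs, abs_of_nonneg ht.1]
    exact mul_le_of_le_one_left (norm_nonneg _) ht.2
  set M := ε + C * ‖y - x‖^2 with hM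
  have hM0 : 0 ≤ M := by positivity
  have step1 : ∀ z ∈ segment ℝ x y,
      ‖fderiv ℝ f z - fderiv ℝ f x - fderiv ℝ (fderiv ℝ f) x (z - x)‖ ≤ M * ‖z - x‖ := by
    intro z hz
    refine Convex.norm_image_sub_le_of_norm_hasFDerivWithin_le'
      (f' := fderiv ℝ (fderiv ℝ f)) (s := segment ℝ x y)
      (fun w hw => (hd2 w (hsub (hseg hw))).hasFDerivWithinAt) ?_ (convex_segment x y)
      (left_mem_segment ℝ x y) hz
    intro w hw
    refine (hosc w (hseg hw)).trans ?_
    have := hnorm w hw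
    rw [hM]; gcongr
  set h := y - x with hh
  have hz : ∀ t ∈ Set.Icc (0:ℝ) 1, x + t • h ∈ segment ℝ x y := by
    intro t ht
    rw [segment_eq_image']
    exact ⟨t, ht, rfl⟩
  have step2 := norm_image_sub_le_of_norm_deriv_le_segment_01'
    (f := fun t : ℝ => f (x + t • h) - t * fderiv ℝ f x h
        - (1/2) * t^2 * fderiv ℝ (fderiv ℝ f) x h h)
    (f' := fun t => (fderiv ℝ f (x + t • h) - fderiv ℝ f x
        - fderiv ℝ (fderiv ℝ f) x ((x + t • h) - x)) h) (C := M * ‖h‖ * ‖h‖) ?_ ?_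
  · simp only [Real.norm_eq_abs] at step2
    have e : x + (1:ℝ) • h = y := by simp [hh]
    rw [e] at step2
    have e2 : M * ‖h‖ * ‖h‖ = ε * ‖h‖^2 + C * ‖h‖^4 := by rw [hM]; ring
    rw [← e2]
    convert step2 using 2
    simp
    ring
  · intro t ht
    apply HasDerivAt.hasDerivWithinAt
    have l : HasDerivAt (fun t : ℝ => x + t • h) h t := by
      simpa using ((hasDerivAt_id t).smul_const h).const_add x
    have a1 := (hd1 _ (hsub (hseg (hz t ht)))).comp_hasDerivAt t l
    have a2 : HasDerivAt (fun t : ℝ => t * fderiv ℝ f x h) (fderiv ℝ f x h) t := by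
      simpa using (hasDerivAt_id t).mul_const (fderiv ℝ f x h)
    have a3 : HasDerivAt (fun t : ℝ => (1/2) * t^2 * fderiv ℝ (fderiv ℝ f) x h h)
        (t * fderiv ℝ (fderiv ℝ f) x h h) t := by
      have := (((hasDerivAt_id t).pow 2).const_mul (1/2)).mul_const (fderiv ℝ (fderiv ℝ f) x h h)
      refine this.congr_deriv ?_
      simp
    refine ((a1.sub a2).sub a3).congr_deriv ?_
    simp only [add_sub_cancel_left, map_smul]
    simp only [ContinuousLinearMap.sub_apply, ContinuousLinearMap.smul_apply, smul_eq_mul]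
  · intro t ht
    have ht' : t ∈ Set.Icc (0:ℝ) 1 := ⟨ht.1, ht.2.le⟩
    refine (ContinuousLinearMap.le_opNorm _ _).trans ?_
    gcongr
    refine (step1 _ (hz t ht')).trans ?_
    gcongr
    exact hnorm _ (hz t ht')

lemma pd2_eq {d : ℕ} (f : (Fin d → ℝ) → ℝ)
    (U : Set (Fin d → ℝ)) (hU : IsOpen U)
    (hf : ContDiffOn ℝ 2 f U) (x : Fin d → ℝ) (hx : x ∈ U) (i j : Fin d) :
    pd2 i j f x = fderiv ℝ (fderiv ℝ f) x (Pi.single i 1) (Pi.single j 1) := by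
  have hf1 : ContDiffOn ℝ 1 (fderiv ℝ f) U := hf.fderiv_of_isOpen hU (by norm_num)
  have hd2 : HasFDerivAt (fderiv ℝ f) (fderiv ℝ (fderiv ℝ f) x) x :=
    ((hf1.differentiableOn (by norm_num)).differentiableAt (hU.mem_nhds hx)).hasFDerivAt
  have := hd2.clm_apply (hasFDerivAt_const (Pi.single j (1:ℝ) : Fin d → ℝ) x)
  change fderiv ℝ (fun y => fderiv ℝ f y (Pi.single j 1)) x (Pi.single i 1) = _
  rw [this.fderiv]
  simp

lemma vnorm_pow_le {d : ℕ} (hd : 2 ≤ d) (h : Fin d → ℝ) (m : ℕ) (hm : Even m) :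
    ‖h‖^m ≤ ∑ a, h a ^ m := by
  have : Nonempty (Fin d) := ⟨⟨0, by omega⟩⟩
  obtain ⟨a, ha⟩ := Finite.exists_max (fun a => ‖h a‖)
  have : ‖h‖ ≤ ‖h a‖ := (pi_norm_le_iff_of_nonneg (norm_nonneg _)).2 ha
  calc ‖h‖^m ≤ ‖h a‖^m := by gcongr
    _ = h a ^ m := by rw [Real.norm_eq_abs, hm.pow_abs]
    _ ≤ _ := Finset.single_le_sum (f := fun a => h a ^ m) (fun i _ => hm.pow_nonneg _) (Finset.mem_univ a)

lemma lin_expand {d : ℕ} (L : (Fin d → ℝ) →L[ℝ] ℝ) (h : Fin d → ℝ) :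
    L h = ∑ i, L (Pi.single i 1) * h i := by
  conv_lhs => rw [pi_eq_sum_univ' h]
  rw [map_sum]
  refine Finset.sum_congr rfl fun i _ => ?_
  have : (fun j => if j = i then (1:ℝ) else 0) = Pi.single i 1 := by
    ext j; simp [Pi.single_apply]
  first
  | rw [map_smul, this, smul_eq_mul, mul_comm]
  | (rw [map_smul, smul_eq_mul, mul_comm])

lemma bil_expand {d : ℕ} (L : (Fin d → ℝ) →L[ℝ] (Fin d → ℝ) →L[ℝ] ℝ) (h : Fin d → ℝ) :
    L h h = ∑ i, ∑ j, L (Pi.single i 1) (Pi.single j 1) * (h i * h j) := by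
  have h1 := lin_expand (L.flip h) h
  simp only [ContinuousLinearMap.flip_apply] at h1
  rw [h1]
  refine Finset.sum_congr rfl fun i _ => ?_
  rw [lin_expand (L (Pi.single i 1)) h, Finset.sum_mul]
  refine Finset.sum_congr rfl fun j _ => ?_
  ring

lemma main_bound (d : ℕ) (hd : 2 ≤ d) (f : (Fin d → ℝ) → ℝ)
    (U : Set (Fin d → ℝ)) (hU : IsOpen U) (hsub : stdSimplex ℝ (Fin d) ⊆ U)
    (hf : ContDiffOn ℝ 2 f U) (ε C : ℝ) (hε : 0 < ε) (hC : 0 ≤ C)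
    (hT : ∀ x ∈ stdSimplex ℝ (Fin d), ∀ y ∈ stdSimplex ℝ (Fin d),
      |f y - f x - fderiv ℝ f x (y - x) - (1/2) * fderiv ℝ (fderiv ℝ f) x (y - x) (y - x)|
        ≤ ε * ‖y - x‖^2 + C * ‖y - x‖^4) (n : ℕ) (hn : 0 < n) (x : Fin d → ℝ)
    (hx : x ∈ stdSimplex ℝ (Fin d)) :
    |(n : ℝ) * (bernsteinOp d n f x - f x) - Ad d f x| ≤ ε * d + 3 * C * d / n := by
  have hn' : (0:ℝ) < n := Nat.cast_pos.2 hn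
  have hx1 : ∀ a, x a ≤ 1 := fun a => by
    rw [← hx.2]; exact Finset.single_le_sum (fun i _ => hx.1 i) (Finset.mem_univ a)
  let G : (Fin d → ℝ) → ℝ := fun s => f (fun i => x i + s i / n)
  have hB : bernsteinOp d n f x = vW x n G := by
    unfold bernsteinOp vW
    refine Finset.sum_congr rfl fun k _ => ?_
    congr 2
    ext i
    field_simp
    ring
  let c1 : Fin d → ℝ := fun i => fderiv ℝ f x (Pi.single i 1) / n
  let c2 : Fin d → Fin d → ℝ := fun i j => pd2 i j f x / (2 * n^2)
  have hlin : vW x n (fun s => ∑ i, c1 i * s i) = 0 := by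
    simp_rw [vW_sum, vW_mul, vW_lin hx]; simp
  have hquad : vW x n (fun s => ∑ i, ∑ j, c2 i j * (s i * s j)) = Ad d f x / n := by
    simp_rw [vW_sum, vW_mul, vW_quad hx, Ad, Finset.mul_sum, Finset.sum_div]
    refine Finset.sum_congr rfl fun i _ => Finset.sum_congr rfl fun j _ => ?_
    simp only [c2]
    field_simp
  let R : (Fin d → ℝ) → ℝ := fun s => G s - f x - (∑ i, c1 i * s i) -
    (∑ i, ∑ j, c2 i j * (s i * s j))
  have hR : (n : ℝ) * (bernsteinOp d n f x - f x) - Ad d f x = n * vW x n R := by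
    have : vW x n R = bernsteinOp d n f x - f x - 0 - Ad d f x / n := by
      simp only [R]
      rw [vW_sub, vW_sub, vW_sub, hlin, hquad, vW_const hx, hB]
    rw [this]; field_simp; ring
  let D : (Fin d → ℝ) → ℝ := fun s => (∑ a, ε / n^2 * (s a * s a)) + ∑ a, C / n^4 * s a ^ 4
  have hRD : |vW x n R| ≤ vW x n D := by
    unfold vW
    refine (Finset.abs_sum_le_sum_abs _ _).trans (Finset.sum_le_sum fun k hk => ?_)
    rw [abs_mul, abs_of_nonneg (mWeight_nonneg hx k)]
    refine mul_le_mul_of_nonneg_left ?_ (mWeight_nonneg hx k)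
    have hk' : ∑ i, k i = n := (Finset.mem_filter.1 hk).2
    have hy : (fun i => (k i : ℝ) / n) ∈ stdSimplex ℝ (Fin d) := by
      refine ⟨fun i => by positivity, ?_⟩
      rw [← Finset.sum_div, ← Nat.cast_sum, hk', div_self hn'.ne']
    have ht := hT x hx _ hy
    set s : Fin d → ℝ := fun i => (k i : ℝ) - n * x i with hs
    have hsh : (fun i => (k i : ℝ) / n) - x = fun i => s i / n := by
      ext i; simp only [hs, Pi.sub_apply]; field_simp
    rw [hsh] at ht
    have hG : G s = f (fun i => (k i : ℝ) / n) := by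
      simp only [G]; congr 1; ext i; simp only [hs]; field_simp; ring
    have hRs : R s = f (fun i => (k i : ℝ) / n) - f x - fderiv ℝ f x (fun i => s i / n)
        - (1/2) * fderiv ℝ (fderiv ℝ f) x (fun i => s i / n) (fun i => s i / n) := by
      simp only [R]
      rw [hG, lin_expand (fderiv ℝ f x), bil_expand, Finset.mul_sum]
      congr 1
      · congr 1
        refine Finset.sum_congr rfl fun i _ => ?_
        simp only [c1]; ring
      · refine Finset.sum_congr rfl fun i _ => ?_
        rw [Finset.mul_sum]
        refine Finset.sum_congr rfl fun j _ => ?_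
        simp only [c2]
        rw [pd2_eq f U hU hf x (hsub hx)]
        field_simp
    rw [hRs]
    refine ht.trans ?_
    have n2 := vnorm_pow_le hd (fun i => s i / n) 2 (by decide)
    have n4 := vnorm_pow_le hd (fun i => s i / n) 4 (by decide)
    have e2 : ∑ a, ε / n^2 * (s a * s a) = ε * ∑ a, (s a / n)^2 := by
      rw [Finset.mul_sum]; exact Finset.sum_congr rfl fun a _ => by field_simp
    have e4 : ∑ a, C / n^4 * s a ^ 4 = C * ∑ a, (s a / n)^4 := by
      rw [Finset.mul_sum]; exact Finset.sum_congr rfl fun a _ => by field_simp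
    simp only [D]
    rw [e2, e4]
    gcongr
  have hD : vW x n D ≤ (∑ a : Fin d, ε / n^2 * n) + ∑ a : Fin d, C / n^4 * (3 * n^2) := by
    simp only [D]
    rw [vW_add, vW_sum, vW_sum]
    refine add_le_add (Finset.sum_le_sum fun a _ => ?_) (Finset.sum_le_sum fun a _ => ?_)
    · rw [vW_mul, vW_quad hx]
      have h0 := hx.1 a
      have h1 := hx1 a
      have : x a * ((if a = a then 1 else 0) - x a) ≤ 1 := by simp; nlinarith
      have h3 : (n:ℝ) * (x a * ((if a = a then 1 else 0) - x a)) ≤ n * 1 := by gcongr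
      rw [mul_one] at h3
      gcongr
    · rw [vW_mul]
      have := vW_four hx n a
      gcongr
  rw [hR, abs_mul, abs_of_pos hn']
  calc (n:ℝ) * |vW x n R| ≤ n * ((∑ a : Fin d, ε / n^2 * n) + ∑ a : Fin d, C / n^4 * (3 * n^2)) := by
        gcongr; exact hRD.trans hD
    _ = ε * d + 3 * C * d / n := by
        simp only [Finset.sum_const, Finset.card_univ, Fintype.card_fin, nsmul_eq_mul]
        field_simp

/-- Voronovskaya-type theorem: for `f` twice continuously differentiable
on an open neighborhood of the simplex,
`lim_{n→∞} max_{x ∈ Δ_{d−1}} |n(B_{d,n} f(x) − f(x)) − 𝒜_d f(x)| = 0`. -/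
theorem voronovskaya_bernstein (d : ℕ) (hd : 2 ≤ d) (f : (Fin d → ℝ) → ℝ)
    (U : Set (Fin d → ℝ)) (hU : IsOpen U) (hsub : stdSimplex ℝ (Fin d) ⊆ U)
    (hf : ContDiffOn ℝ 2 f U) :
    Tendsto (fun n : ℕ => ⨆ x ∈ stdSimplex ℝ (Fin d),
        |(n : ℝ) * (bernsteinOp d n f x - f x) - Ad d f x|)
      atTop (nhds 0) := by
  rw [Metric.tendsto_atTop]
  intro η hη
  have hd' : (0:ℝ) < d := by exact_mod_cast (by omega : 0 < d)
  obtain ⟨C, hC, hT⟩ := taylor_bound f U hU hsub hf (η / (4 * d)) (by positivity)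
  obtain ⟨N, hN⟩ := exists_nat_gt (3 * C * d / (η / 4))
  refine ⟨N + 1, fun n hn => ?_⟩
  have hn0 : 0 < n := by omega
  have hn' : (0:ℝ) < n := Nat.cast_pos.2 hn0
  have hNn : (N:ℝ) ≤ n := by exact_mod_cast (by omega : N ≤ n)
  have hb : η / (4 * d) * d + 3 * C * d / n ≤ η / 2 := by
    have h1 : η / (4 * d) * d = η / 4 := by field_simp
    have h2 : 3 * C * d / n ≤ η / 4 := by
      rw [div_le_iff₀ hn']
      rw [div_lt_iff₀ (by positivity)] at hN
      nlinarith
    linarith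
  have hnn : 0 ≤ ⨆ x ∈ stdSimplex ℝ (Fin d),
        |(n : ℝ) * (bernsteinOp d n f x - f x) - Ad d f x| :=
    Real.iSup_nonneg fun x => Real.iSup_nonneg fun _ => abs_nonneg _
  rw [Real.dist_eq, sub_zero, abs_of_nonneg hnn]
  refine lt_of_le_of_lt (Real.iSup_le (fun x => Real.iSup_le (fun hx => ?_) (by positivity))
    (by positivity)) (half_lt_self hη)
  exact (main_bound d hd f U hU hsub hf _ C (by positivity) hC hT n hn0 x hx).trans hb
end
end

section
/- (Quantitative Voronovskaya-type theorem.) Let f : ℝ^d → ℝ be twice continuously differentiable on an open neighborhood of Δ_{d−1}, and assume every second partial derivative ∂²f/∂x_i∂x_j is Lipschitz continuous on Δ_{d−1}, with Lipschitz constant Lip(∂_{ij}f) with respect to the Euclidean norm. Then for every n ∈ ℕ, max_{x ∈ Δ_{d−1}} |n(B_{d,n} f(x) − f(x)) − 𝒜_d f(x)| ≤ (d^{5/2}/(16·3^{1/4})) · max_{i,j=1,…,d} Lip(∂_{ij}f) · n^{−1/2}. -/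
open Finset Filter MeasureTheory

noncomputable section

/-- The Euclidean norm on `Fin d → ℝ`. -/
def eucNorm {d : ℕ} (v : Fin d → ℝ) : ℝ := Real.sqrt (∑ i, v i ^ 2)

/-- expectation -/
def Ex {d : ℕ} (x : Fin d → ℝ) (n : ℕ) (g : (Fin d → ℕ) → ℝ) : ℝ :=
  ∑ k ∈ multiIdx d n, mWeight x k * g k

def Lam {d : ℕ} (g : (Fin d → ℕ) → ℝ) : MvPolynomial (Fin d) ℝ →ₗ[ℝ] ℝ :=
  (MvPolynomial.basisMonomials (Fin d) ℝ).constr ℝ (fun k : Fin d →₀ ℕ => g k)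

lemma Lam_monomial {d : ℕ} (g : (Fin d → ℕ) → ℝ) (k : Fin d →₀ ℕ) (c : ℝ) :
    Lam g (MvPolynomial.monomial k c) = c * g k := by
  have h : MvPolynomial.monomial k c = c • (MvPolynomial.basisMonomials (Fin d) ℝ k) := by
    simp [MvPolynomial.smul_monomial]
  rw [h, map_smul, Lam, Module.Basis.constr_basis, smul_eq_mul]

lemma Lam_X_mul {d : ℕ} (g : (Fin d → ℕ) → ℝ) (j : Fin d) (p : MvPolynomial (Fin d) ℝ) :
    Lam g (MvPolynomial.X j * p) = Lam (fun k => g (k + Pi.single j 1)) p := by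
  induction p using MvPolynomial.induction_on' with
  | monomial k c =>
    rw [MvPolynomial.X, MvPolynomial.monomial_mul, Lam_monomial, Lam_monomial, one_mul]
    congr 2
    rw [add_comm]
    simp [Finsupp.single_eq_pi_single]
  | add p q hp hq => rw [mul_add, map_add, map_add, hp, hq]

lemma Ex_eq_Lam {d : ℕ} (x : Fin d → ℝ) (n : ℕ) (g : (Fin d → ℕ) → ℝ) :
    Ex x n g = Lam g ((∑ i, MvPolynomial.C (x i) * MvPolynomial.X i) ^ n) := by
  rw [Finset.sum_pow_eq_sum_piAntidiag, map_sum, Ex, multiIdx_eq]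
  refine Finset.sum_congr rfl fun k _ => ?_
  have : ((Nat.multinomial univ k : ℕ) : MvPolynomial (Fin d) ℝ) *
      ∏ i, (MvPolynomial.C (x i) * MvPolynomial.X i) ^ k i
      = MvPolynomial.monomial (Finsupp.equivFunOnFinite.symm k) (mWeight x k) := by
    rw [MvPolynomial.monomial_eq, mWeight]
    simp only [mul_pow, Finset.prod_mul_distrib, map_mul, map_prod, map_pow, map_natCast]
    rw [Finsupp.prod_fintype _ _ (by simp)]
    simp [mul_assoc]
  rw [this, Lam_monomial]
  simp

lemma Ex_succ {d : ℕ} (x : Fin d → ℝ) (n : ℕ) (g : (Fin d → ℕ) → ℝ) :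
    Ex x (n+1) g = ∑ j, x j * Ex x n (fun k => g (k + Pi.single j 1)) := by
  simp only [Ex_eq_Lam]
  rw [pow_succ', Finset.sum_mul, map_sum]
  refine Finset.sum_congr rfl fun j _ => ?_
  rw [mul_assoc, ← MvPolynomial.smul_eq_C_mul, map_smul, Lam_X_mul, smul_eq_mul]

lemma Ex_zero {d : ℕ} (x : Fin d → ℝ) (g : (Fin d → ℕ) → ℝ) :
    Ex x 0 g = g 0 := by
  rw [Ex_eq_Lam, pow_zero, ← MvPolynomial.C_1, MvPolynomial.C_apply, Lam_monomial]
  simp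

lemma Ex_add {d : ℕ} (x : Fin d → ℝ) (n : ℕ) (g h : (Fin d → ℕ) → ℝ) :
    Ex x n (fun k => g k + h k) = Ex x n g + Ex x n h := by
  simp [Ex, mul_add, Finset.sum_add_distrib]

lemma Ex_smul {d : ℕ} (x : Fin d → ℝ) (n : ℕ) (c : ℝ) (g : (Fin d → ℕ) → ℝ) :
    Ex x n (fun k => c * g k) = c * Ex x n g := by
  simp only [Ex, Finset.mul_sum]
  exact Finset.sum_congr rfl fun k _ => by ring

lemma Ex_sum {d : ℕ} {ι : Type*} (s : Finset ι) (x : Fin d → ℝ) (n : ℕ) (g : ι → (Fin d → ℕ) → ℝ) :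
    Ex x n (fun k => ∑ i ∈ s, g i k) = ∑ i ∈ s, Ex x n (g i) := by
  simp only [Ex, Finset.mul_sum]
  exact Finset.sum_comm

lemma Ex_mono {d : ℕ} {x : Fin d → ℝ} (hx : x ∈ stdSimplex ℝ (Fin d)) (n : ℕ)
    (g h : (Fin d → ℕ) → ℝ) (H : ∀ k ∈ multiIdx d n, g k ≤ h k) : Ex x n g ≤ Ex x n h :=
  Finset.sum_le_sum fun k hk => mul_le_mul_of_nonneg_left (H k hk) (mWeight_nonneg hx k)

lemma Ex_one {d : ℕ} {x : Fin d → ℝ} (hx : x ∈ stdSimplex ℝ (Fin d)) (n : ℕ) :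
    Ex x n (fun _ => 1) = 1 := by
  induction n with
  | zero => rw [Ex_zero]
  | succ n ih => rw [Ex_succ]; simp [ih, hx.2]

lemma Ex_const {d : ℕ} {x : Fin d → ℝ} (hx : x ∈ stdSimplex ℝ (Fin d)) (n : ℕ) (c : ℝ) :
    Ex x n (fun _ => c) = c := by
  have := Ex_smul x n c (fun _ => 1)
  simpa [Ex_one hx] using this

/-- centered coordinate -/
def cS {d : ℕ} (x : Fin d → ℝ) (n : ℕ) (i : Fin d) (k : Fin d → ℕ) : ℝ := (k i : ℝ) - n * x i

lemma cS_succ {d : ℕ} (x : Fin d → ℝ) (n : ℕ) (i j : Fin d) (k : Fin d → ℕ) :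
    cS x (n+1) i (k + Pi.single j 1) = cS x n i k + ((if i = j then 1 else 0) - x i) := by
  simp only [cS, Pi.add_apply, Pi.single_apply]
  push_cast
  ring

lemma Ex_c1 {d : ℕ} {x : Fin d → ℝ} (hx : x ∈ stdSimplex ℝ (Fin d)) (n : ℕ) (i : Fin d) :
    Ex x n (cS x n i) = 0 := by
  induction n with
  | zero => rw [Ex_zero]; simp [cS]
  | succ n ih =>
    rw [Ex_succ]
    simp only [cS_succ]
    simp only [Ex_add, ih, Ex_const hx, zero_add, mul_sub, Finset.sum_sub_distrib,
      ← Finset.sum_mul, hx.2]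
    simp

lemma Ex_c2 {d : ℕ} {x : Fin d → ℝ} (hx : x ∈ stdSimplex ℝ (Fin d)) (n : ℕ) (i j : Fin d) :
    Ex x n (fun k => cS x n i k * cS x n j k) = n * (x i * ((if i = j then 1 else 0) - x j)) := by
  induction n with
  | zero => rw [Ex_zero]; simp [cS]
  | succ n ih =>
    rw [Ex_succ]
    have key : ∀ l, Ex x n (fun k => cS x (n+1) i (k + Pi.single l 1) * cS x (n+1) j (k + Pi.single l 1))
        = n * (x i * ((if i = j then 1 else 0) - x j)) +
          ((if i = l then 1 else 0) - x i) * ((if j = l then 1 else 0) - x j) := by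
      intro l
      simp only [cS_succ]
      set a : ℝ := ((if i = l then 1 else 0) - x i)
      set b : ℝ := ((if j = l then 1 else 0) - x j)
      have : (fun k => (cS x n i k + a) * (cS x n j k + b)) = fun k =>
          cS x n i k * cS x n j k + (b * cS x n i k + (a * cS x n j k + a * b)) := by
        funext k; ring
      rw [this, Ex_add, Ex_add, Ex_add, Ex_smul, Ex_smul, Ex_c1 hx, Ex_c1 hx, Ex_const hx, ih]
      ring
    simp only [key]
    have h2 : ∀ l, x l * ((n:ℝ) * (x i * ((if i = j then 1 else 0) - x j)) +
          ((if i = l then 1 else 0) - x i) * ((if j = l then 1 else 0) - x j))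
        = x l * ((n:ℝ) * (x i * ((if i = j then 1 else 0) - x j)) + x i * x j)
          + (if i = l then x l * (if j = l then 1 else 0) else 0)
          - x j * (if i = l then x l else 0) - x i * (if j = l then x l else 0) := by
      intro l; split_ifs <;> ring
    simp only [h2, Finset.sum_sub_distrib, Finset.sum_add_distrib, ← Finset.sum_mul,
      ← Finset.mul_sum, hx.2, Finset.sum_ite_eq, Finset.mem_univ, if_true]
    push_cast
    by_cases h : i = j
    · subst h; simp; ring
    · simp [h, Ne.symm h]; ring

lemma Ex_c4 {d : ℕ} {x : Fin d → ℝ} (hx : x ∈ stdSimplex ℝ (Fin d)) (n : ℕ) (i : Fin d) :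
    Ex x n (fun k => cS x n i k ^ 4) = 3 * n^2 * (x i * (1 - x i))^2
      + n * (x i * (1 - x i)) * (1 - 6 * (x i * (1 - x i))) := by
  induction n with
  | zero => rw [Ex_zero]; simp [cS]
  | succ n ih =>
    rw [Ex_succ]
    have key : ∀ l, Ex x n (fun k => cS x (n+1) i (k + Pi.single l 1) ^ 4)
        = Ex x n (fun k => cS x n i k ^ 4) + (4 * Ex x n (fun k => cS x n i k ^ 3) * 
          ((if i = l then 1 else 0) - x i) + 6 * (n * (x i * (1 - x i))) * 
          ((if i = l then 1 else 0) - x i)^2 + ((if i = l then 1 else 0) - x i)^4) := by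
      intro l
      simp only [cS_succ]
      set a : ℝ := ((if i = l then 1 else 0) - x i)
      have : (fun k => (cS x n i k + a) ^ 4) = fun k =>
          cS x n i k ^ 4 + ((4 * a) * cS x n i k ^ 3 + ((6 * a ^ 2) * (cS x n i k * cS x n i k)
          + ((4 * a^3) * cS x n i k + a ^ 4))) := by
        funext k; ring
      rw [this, Ex_add, Ex_add, Ex_add, Ex_add, Ex_smul, Ex_smul, Ex_smul, Ex_c1 hx, Ex_c2 hx,
        Ex_const hx]
      simp only [if_true]
      ring
    simp only [key]
    generalize Ex x n (fun k => cS x n i k ^ 3) = T at *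
    rw [ih]
    have h2 : ∀ A B : ℝ, ∀ l, x l * (A + (4 * T * 
          ((if i = l then 1 else 0) - x i) + B * 
          ((if i = l then 1 else 0) - x i)^2 + ((if i = l then 1 else 0) - x i)^4))
        = x l * (A - 4 * T * x i + B * x i ^ 2 + x i ^ 4)
          + (4 * T + B * (1 - 2 * x i) + ((1 - x i)^4 - x i ^4)) * (if i = l then x l else 0) := by
      intro A B l; split_ifs <;> ring
    simp only [h2, Finset.sum_add_distrib, ← Finset.sum_mul,
      ← Finset.mul_sum, hx.2, Finset.sum_ite_eq, Finset.mem_univ, if_true]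
    push_cast
    ring

lemma Ex_c2_le {d : ℕ} {x : Fin d → ℝ} (hx : x ∈ stdSimplex ℝ (Fin d)) (n : ℕ) (i : Fin d) :
    Ex x n (fun k => cS x n i k ^ 2) ≤ n / 4 := by
  have := Ex_c2 hx n i i
  simp only [← pow_two, if_true] at this
  rw [this]
  have : (0:ℝ) ≤ n := Nat.cast_nonneg n
  nlinarith [mul_nonneg this (sq_nonneg (x i - 1/2))]

lemma Ex_c4_le {d : ℕ} {x : Fin d → ℝ} (hx : x ∈ stdSimplex ℝ (Fin d)) (n : ℕ) (hn : 1 ≤ n)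
    (i : Fin d) :
    Ex x n (fun k => cS x n i k ^ 4) ≤ 3 * n^2 / 16 := by
  rw [Ex_c4 hx]
  have hn' : (1:ℝ) ≤ n := by exact_mod_cast hn
  have h0 := hx.1 i
  have h1 : x i ≤ 1 := by
    rw [← hx.2]; exact Finset.single_le_sum (fun j _ => hx.1 j) (Finset.mem_univ i)
  have hs0 : 0 ≤ x i * (1 - x i) := mul_nonneg h0 (by linarith)
  have hs1 : x i * (1 - x i) ≤ 1/4 := by nlinarith [sq_nonneg (x i - 1/2)]
  generalize x i * (1 - x i) = s at *
  have hs2 : s^2 ≤ 1/16 := by nlinarith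
  by_cases h : 1 - 6 * s ≤ 0
  · have : (n:ℝ) * s * (1 - 6 * s) ≤ 0 := mul_nonpos_of_nonneg_of_nonpos (by positivity) h
    nlinarith [sq_nonneg (n:ℝ)]
  · push Not at h
    have : (n:ℝ) * s * (1 - 6 * s) ≤ n^2 * (s * (1 - 6 * s)) := by
      have : 0 ≤ s * (1 - 6*s) := mul_nonneg hs0 h.le
      nlinarith [mul_nonneg this (mul_nonneg (by linarith : (0:ℝ) ≤ n) (by linarith : (0:ℝ) ≤ n - 1))]
    have h3 : s - 3 * s^2 ≤ 3/16 := by nlinarith [sq_nonneg (s - 1/6)]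
    nlinarith [mul_le_mul_of_nonneg_left h3 (sq_nonneg (n:ℝ))]

lemma taylor1 (φ φ' φ'' : ℝ → ℝ) (M : ℝ)
    (h1 : ∀ t ∈ Set.Icc (0:ℝ) 1, HasDerivAt φ (φ' t) t)
    (h2 : ∀ t ∈ Set.Icc (0:ℝ) 1, HasDerivAt φ' (φ'' t) t)
    (hM : ∀ t ∈ Set.Icc (0:ℝ) 1, |φ'' t - φ'' 0| ≤ M * t) :
    |φ 1 - φ 0 - φ' 0 - φ'' 0 / 2| ≤ M / 6 := by
  have s1 : ∀ t ∈ Set.Icc (0:ℝ) 1, HasDerivAt (fun t => φ' t - φ' 0 - φ'' 0 * t) (φ'' t - φ'' 0) t := by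
    intro t ht
    have := ((h2 t ht).sub_const (φ' 0)).sub ((hasDerivAt_id t).const_mul (φ'' 0))
    exact this.congr_deriv (by simp)
  have s2 : ∀ t ∈ Set.Icc (0:ℝ) 1, HasDerivAt (fun t => φ t - φ 0 - φ' 0 * t - φ'' 0 / 2 * t ^ 2)
      (φ' t - φ' 0 - φ'' 0 * t) t := by
    intro t ht
    have := (((h1 t ht).sub_const (φ 0)).sub ((hasDerivAt_id t).const_mul (φ' 0))).sub
      ((hasDerivAt_pow 2 t).const_mul (φ'' 0 / 2))
    refine (this.congr_deriv ?_)
    simp; ring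
  have b1 : ∀ ⦃t⦄, t ∈ Set.Icc (0:ℝ) 1 → ‖φ' t - φ' 0 - φ'' 0 * t‖ ≤ M / 2 * t ^ 2 := by
    refine image_norm_le_of_norm_deriv_right_le_deriv_boundary
      (f := fun t => φ' t - φ' 0 - φ'' 0 * t) (B' := fun t => M * t)
      (fun t ht => (s1 t ht).continuousAt.continuousWithinAt)
      (fun t ht => (s1 t (Set.Ico_subset_Icc_self ht)).hasDerivWithinAt) (by simp) ?_
      (fun t ht => hM t (Set.Ico_subset_Icc_self ht))
    intro t
    refine ((hasDerivAt_pow 2 t).const_mul (M / 2)).congr_deriv ?_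
    simp; ring
  have b2 : ∀ ⦃t⦄, t ∈ Set.Icc (0:ℝ) 1 → ‖φ t - φ 0 - φ' 0 * t - φ'' 0 / 2 * t ^ 2‖ ≤ M / 6 * t ^ 3 := by
    refine image_norm_le_of_norm_deriv_right_le_deriv_boundary
      (f := fun t => φ t - φ 0 - φ' 0 * t - φ'' 0 / 2 * t ^ 2) (B' := fun t => M / 2 * t ^ 2)
      (fun t ht => (s2 t ht).continuousAt.continuousWithinAt)
      (fun t ht => (s2 t (Set.Ico_subset_Icc_self ht)).hasDerivWithinAt) (by simp) ?_
      (fun t ht => b1 (Set.Ico_subset_Icc_self ht))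
    intro t
    refine ((hasDerivAt_pow 3 t).const_mul (M / 6)).congr_deriv ?_
    simp; ring
  have := b2 (Set.right_mem_Icc.2 zero_le_one)
  simpa using this

lemma vec_eq {d : ℕ} (v : Fin d → ℝ) : v = ∑ i, v i • (Pi.single i 1 : Fin d → ℝ) := by
  funext j
  simp [Finset.sum_apply, Pi.single_apply]

lemma taylorf {d : ℕ} (f : (Fin d → ℝ) → ℝ)
    (U : Set (Fin d → ℝ)) (hU : IsOpen U) (hsub : stdSimplex ℝ (Fin d) ⊆ U)
    (hf : ContDiffOn ℝ 2 f U) (L : ℝ) 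
    (hLip : ∀ i j : Fin d, ∀ x ∈ stdSimplex ℝ (Fin d), ∀ y ∈ stdSimplex ℝ (Fin d),
      |pd2 i j f x - pd2 i j f y| ≤ L * eucNorm (x - y))
    (x y : Fin d → ℝ) (hx : x ∈ stdSimplex ℝ (Fin d)) (hy : y ∈ stdSimplex ℝ (Fin d)) :
    |f y - f x - ∑ i, (y i - x i) * pd i f x
      - (∑ i, ∑ j, (y i - x i) * (y j - x j) * pd2 i j f x) / 2|
      ≤ L * eucNorm (y - x) * (∑ i, |y i - x i|) ^ 2 / 6 := by
  set v := y - x with hv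
  have hvi : ∀ i, y i - x i = v i := fun i => rfl
  simp only [hvi]
  let p : ℝ → (Fin d → ℝ) := fun t => x + t • v
  have hp : ∀ t ∈ Set.Icc (0:ℝ) 1, p t ∈ stdSimplex ℝ (Fin d) := by
    intro t ht
    have := (convex_stdSimplex ℝ (Fin d)).add_smul_sub_mem hx hy ht
    exact this
  have hpd : ∀ t, HasDerivAt p v t := by
    intro t
    have := ((hasDerivAt_id t).smul_const v).const_add x
    exact this.congr_deriv (by simp)
  have hC : ∀ t ∈ Set.Icc (0:ℝ) 1, ContDiffAt ℝ 2 f (p t) := fun t ht =>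
    hf.contDiffAt (hU.mem_nhds (hsub (hp t ht)))
  have hD1 : ∀ t ∈ Set.Icc (0:ℝ) 1, DifferentiableAt ℝ f (p t) := fun t ht =>
    (hC t ht).differentiableAt (by norm_num)
  have hD2 : ∀ t ∈ Set.Icc (0:ℝ) 1, DifferentiableAt ℝ (fderiv ℝ f) (p t) := fun t ht =>
    ((hC t ht).fderiv_right (m := 1) (by norm_num)).differentiableAt (by norm_num)
  have hpd2 : ∀ t ∈ Set.Icc (0:ℝ) 1, ∀ i j, pd2 i j f (p t)
      = fderiv ℝ (fderiv ℝ f) (p t) (Pi.single i 1) (Pi.single j 1) := by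
    intro t ht i j
    have h : HasFDerivAt (pd j f) _ (p t) :=
      (hD2 t ht).hasFDerivAt.clm_apply (hasFDerivAt_const (Pi.single j (1:ℝ) : Fin d → ℝ) (p t))
    rw [pd2, pd, h.fderiv]
    simp
  have hp0 : p 0 = x := by simp [p]
  have hp1 : p 1 = y := by simp [p, hv]
  have key := taylor1 (fun t => f (p t)) (fun t => fderiv ℝ f (p t) v)
    (fun t => ∑ i, ∑ j, v i * v j * pd2 i j f (p t)) (L * eucNorm v * (∑ i, |v i|) ^ 2)
    (fun t ht => (hD1 t ht).hasFDerivAt.comp_hasDerivAt t (hpd t)) ?_ ?_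
  · simp only [hp0, hp1] at key
    have : fderiv ℝ f x v = ∑ i, v i * pd i f x := by
      conv_lhs => rw [vec_eq v]
      simp [map_sum, pd]
    rwa [this] at key
  · intro t ht
    have h1 : HasDerivAt (fun t => fderiv ℝ f (p t)) (fderiv ℝ (fderiv ℝ f) (p t) v) t :=
      (hD2 t ht).hasFDerivAt.comp_hasDerivAt t (hpd t)
    have h2 := h1.clm_apply (hasDerivAt_const t v)
    refine h2.congr_deriv ?_
    simp only [hpd2 t ht, map_zero, add_zero]
    generalize fderiv ℝ (fderiv ℝ f) (p t) = H
    conv_lhs => rw [vec_eq v]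
    simp only [map_sum, map_smul, _root_.sum_apply, _root_.smul_apply, smul_eq_mul,
      Finset.mul_sum]
    exact Finset.sum_comm.trans (Finset.sum_congr rfl fun i _ => Finset.sum_congr rfl fun j _ => by ring)
  · intro t ht
    simp only [hp0]
    rw [← Finset.sum_sub_distrib]
    simp only [← Finset.sum_sub_distrib, ← mul_sub]
    have he : eucNorm (p t - x) = t * eucNorm v := by
      simp only [eucNorm, p, add_sub_cancel_left, Pi.smul_apply, smul_eq_mul, mul_pow,
        ← Finset.mul_sum]
      rw [Real.sqrt_mul (sq_nonneg t), Real.sqrt_sq ht.1]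
    calc |∑ i, ∑ j, v i * v j * (pd2 i j f (p t) - pd2 i j f x)|
        ≤ ∑ i, ∑ j, |v i * v j * (pd2 i j f (p t) - pd2 i j f x)| :=
          (Finset.abs_sum_le_sum_abs _ _).trans
            (Finset.sum_le_sum fun i _ => Finset.abs_sum_le_sum_abs _ _)
      _ ≤ ∑ i, ∑ j, |v i| * |v j| * (L * (t * eucNorm v)) := by
          refine Finset.sum_le_sum fun i _ => Finset.sum_le_sum fun j _ => ?_
          rw [abs_mul, abs_mul, ← he]
          exact mul_le_mul_of_nonneg_left (hLip i j _ (hp t ht) x hx) (by positivity)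
      _ = _ := by
          rw [pow_two, Finset.sum_mul_sum]
          simp only [Finset.mul_sum, Finset.sum_mul]
          exact Finset.sum_congr rfl fun i _ => Finset.sum_congr rfl fun j _ => by ring

lemma cube_bound {d : ℕ} (v : Fin d → ℝ) (a : ℝ) (ha : 0 < a) :
    eucNorm v * (∑ i, |v i|) ^ 2 ≤ d * ∑ i, (a * v i ^ 2 + d * v i ^ 4 / a) / 2 := by
  have h1 : (∑ i, |v i|) ^ 2 ≤ d * ∑ i, v i ^ 2 := by
    have := sq_sum_le_card_mul_sum_sq (s := Finset.univ) (f := fun i => |v i|)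
    simpa using this
  have h2 : (∑ i, v i ^ 2) ^ 2 ≤ d * ∑ i, v i ^ 4 := by
    have := sq_sum_le_card_mul_sum_sq (s := Finset.univ) (f := fun i => v i ^ 2)
    simpa [← pow_mul] using this
  have hS : 0 ≤ ∑ i, v i ^ 2 := Finset.sum_nonneg fun i _ => sq_nonneg _
  have he : eucNorm v ^ 2 = ∑ i, v i ^ 2 := Real.sq_sqrt hS
  have he0 : 0 ≤ eucNorm v := Real.sqrt_nonneg _
  have hr : ∑ i, (a * v i ^ 2 + d * v i ^ 4 / a) / 2
      = (a * (∑ i, v i ^ 2) + (d * ∑ i, v i ^ 4) / a) / 2 := by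
    rw [← Finset.sum_div, Finset.sum_add_distrib, Finset.mul_sum, Finset.mul_sum, Finset.sum_div]
  rw [hr]
  have h3 : eucNorm v * (∑ i, v i ^ 2) ≤
      (a * (∑ i, v i ^ 2) + (d * ∑ i, v i ^ 4) / a) / 2 := by
    have h4 : (∑ i, v i ^ 2) ^ 2 / a ≤ (d * ∑ i, v i ^ 4) / a := by gcongr
    have h5 : eucNorm v * (∑ i, v i ^ 2) ≤ (a * (∑ i, v i ^ 2) + (∑ i, v i ^ 2) ^ 2 / a) / 2 := by
      rw [← he]
      generalize eucNorm v = e at *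
      have : (a * e ^ 2 + (e ^ 2) ^ 2 / a) / 2 - e * e ^ 2 = e ^ 2 * (a - e) ^ 2 / (2 * a) := by
        field_simp; ring
      have h6 : 0 ≤ e ^ 2 * (a - e) ^ 2 / (2 * a) := by positivity
      linarith
    linarith
  calc eucNorm v * (∑ i, |v i|) ^ 2 ≤ eucNorm v * (d * ∑ i, v i ^ 2) := by gcongr
    _ = d * (eucNorm v * ∑ i, v i ^ 2) := by ring
    _ ≤ _ := by gcongr

/-- quantitative Voronovskaya-type theorem: if `f` is C² on a
neighborhood of the simplex and each second partial derivative is Lipschitz on the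
simplex with (common, i.e. maximal) Lipschitz constant `L`, then for every `n ≥ 1`,
`max_{x ∈ Δ_{d−1}} |n(B_{d,n} f(x) − f(x)) − 𝒜_d f(x)|
   ≤ (d^{5/2}/(16·3^{1/4})) · L · n^{−1/2}`. -/
theorem voronovskaya_bernstein_rate (d : ℕ) (hd : 2 ≤ d) (f : (Fin d → ℝ) → ℝ)
    (U : Set (Fin d → ℝ)) (hU : IsOpen U) (hsub : stdSimplex ℝ (Fin d) ⊆ U)
    (hf : ContDiffOn ℝ 2 f U)
    (L : ℝ)
    (hLip : ∀ i j : Fin d, ∀ x ∈ stdSimplex ℝ (Fin d), ∀ y ∈ stdSimplex ℝ (Fin d),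
      |pd2 i j f x - pd2 i j f y| ≤ L * eucNorm (x - y))
    (n : ℕ) (hn : 1 ≤ n) :
    ∀ x ∈ stdSimplex ℝ (Fin d),
      |(n : ℝ) * (bernsteinOp d n f x - f x) - Ad d f x|
        ≤ (d : ℝ) ^ ((5 : ℝ) / 2) / (16 * (3 : ℝ) ^ ((1 : ℝ) / 4)) * L
            * ((n : ℝ) ^ (-(1 : ℝ) / 2)) := by
  intro x hx
  have hn0 : (0:ℝ) < n := by exact_mod_cast hn
  have hd0 : (0:ℝ) < d := by exact_mod_cast (by omega : 0 < d)
  have hL : 0 ≤ L := by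
    have h01 : (⟨0, by omega⟩ : Fin d) ≠ ⟨1, by omega⟩ := by simp
    have h := hLip ⟨0, by omega⟩ ⟨0, by omega⟩ _ (single_mem_stdSimplex ℝ (⟨0, by omega⟩ : Fin d))
      _ (single_mem_stdSimplex ℝ (⟨1, by omega⟩ : Fin d))
    have h2 := (abs_nonneg _).trans h
    refine nonneg_of_mul_nonneg_left h2 ?_
    apply Real.sqrt_pos.2
    refine Finset.sum_pos' (fun i _ => sq_nonneg _) ⟨⟨0, by omega⟩, Finset.mem_univ _, ?_⟩
    simp
  -- points
  have hy : ∀ k ∈ multiIdx d n, (fun i => (k i : ℝ) / n) ∈ stdSimplex ℝ (Fin d) := by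
    intro k hk
    have hk2 : ∑ i, k i = n := (Finset.mem_filter.1 hk).2
    refine ⟨fun i => by positivity, ?_⟩
    rw [← Finset.sum_div, ← Nat.cast_sum, hk2, div_self hn0.ne']
  have hc : ∀ (k : Fin d → ℕ) i, (k i : ℝ) / n - x i = cS x n i k / n := by
    intro k i; rw [cS]; field_simp
  set a : ℝ := Real.sqrt (d / n) with ha
  have ha0 : 0 < a := Real.sqrt_pos.2 (by positivity)
  have ha2 : a ^ 2 = d / n := Real.sq_sqrt (by positivity)
  let R : (Fin d → ℕ) → ℝ := fun k => f (fun i => (k i : ℝ) / n) - f x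
    - ∑ i, cS x n i k / n * pd i f x
    - (∑ i, ∑ j, cS x n i k / n * (cS x n j k / n) * pd2 i j f x) / 2
  let Q : (Fin d → ℕ) → ℝ := fun k => L * d / 6 *
    ∑ i, (a / (2 * n ^ 2) * cS x n i k ^ 2 + d / (2 * a * n ^ 4) * cS x n i k ^ 4)
  have hR : ∀ k ∈ multiIdx d n, |R k| ≤ Q k := by
    intro k hk
    have h1 := taylorf f U hU hsub hf L hLip x _ hx (hy k hk)
    have h2 := cube_bound ((fun i => (k i : ℝ) / n) - x) a ha0
    simp only [Pi.sub_apply] at h2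
    simp only [hc] at h1 h2
    refine h1.trans ?_
    have h3 := mul_le_mul_of_nonneg_left h2 (by positivity : 0 ≤ L / 6)
    refine (le_of_eq (by ring)).trans (h3.trans (le_of_eq ?_))
    simp only [Q]
    rw [← mul_assoc]
    congr 1
    · ring
    · refine Finset.sum_congr rfl fun i _ => ?_
      field_simp
  have hEQ : Ex x n Q ≤ L * d / 6 * (d * (a / (2 * n ^ 2) * (n / 4) 
      + d / (2 * a * n ^ 4) * (3 * n ^ 2 / 16))) := by
    simp only [Q]
    rw [Ex_smul, Ex_sum]
    refine mul_le_mul_of_nonneg_left ?_ (by positivity)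
    calc _ ≤ ∑ i : Fin d, (a / (2 * n ^ 2) * (n / 4) 
          + d / (2 * a * n ^ 4) * (3 * (n:ℝ) ^ 2 / 16)) := by
          refine Finset.sum_le_sum fun i _ => ?_
          rw [Ex_add, Ex_smul, Ex_smul]
          have := Ex_c2_le hx n i
          have := Ex_c4_le hx n hn i
          gcongr
      _ = _ := by simp [mul_add]
  have hER : |Ex x n R| ≤ Ex x n Q := by
    rw [abs_le]
    constructor
    · have := Ex_mono hx n (fun k => (-1) * Q k) R fun k hk => by
        have := (abs_le.1 (hR k hk)).1; linarith
      rw [Ex_smul] at this; linarith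
    · exact Ex_mono hx n _ _ fun k hk => (abs_le.1 (hR k hk)).2
  have hB : bernsteinOp d n f x - f x = Ex x n R + Ad d f x / n := by
    have e1 : bernsteinOp d n f x = Ex x n (fun k => f x + ((∑ i, (pd i f x / n) * cS x n i k) +
        ((∑ i, ∑ j, (pd2 i j f x / (2 * n ^ 2)) * (cS x n i k * cS x n j k)) + R k))) := by
      refine Finset.sum_congr rfl fun k _ => ?_
      congr 1
      have q1 : ∑ i, (pd i f x / n) * cS x n i k = ∑ i, cS x n i k / n * pd i f x :=
        Finset.sum_congr rfl fun i _ => by ring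
      have q2 : ∑ i, ∑ j, (pd2 i j f x / (2 * n ^ 2)) * (cS x n i k * cS x n j k)
          = (∑ i, ∑ j, cS x n i k / n * (cS x n j k / n) * pd2 i j f x) / 2 := by
        rw [Finset.sum_div]
        refine Finset.sum_congr rfl fun i _ => ?_
        rw [Finset.sum_div]
        refine Finset.sum_congr rfl fun j _ => ?_
        field_simp
      beta_reduce
      rw [q1, q2]
      simp only [R]
      ring
    rw [e1, Ex_add, Ex_add, Ex_add, Ex_const hx, Ex_sum, Ex_sum]
    simp only [Ex_sum, Ex_smul, Ex_c2 hx]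
    have z : ∑ i, pd i f x / n * Ex x n (fun k => cS x n i k) = 0 :=
      Finset.sum_eq_zero fun i _ => by
        have := Ex_c1 hx n i
        rw [show (fun k => cS x n i k) = cS x n i from rfl, this, mul_zero]
    rw [z]
    have w : ∑ i, ∑ j, pd2 i j f x / (2 * n ^ 2) * (n * (x i * ((if i = j then 1 else 0) - x j)))
        = Ad d f x / n := by
      rw [Ad, Finset.mul_sum, Finset.sum_div]
      refine Finset.sum_congr rfl fun i _ => ?_
      rw [Finset.mul_sum, Finset.sum_div]
      refine Finset.sum_congr rfl fun j _ => ?_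
      field_simp
    rw [w]
    ring
  have hm : (n : ℝ) * (bernsteinOp d n f x - f x) - Ad d f x = n * Ex x n R := by
    rw [hB]; field_simp; ring
  rw [hm, abs_mul, abs_of_pos hn0]
  have hfin : (n:ℝ) * (L * d / 6 * (d * (a / (2 * n ^ 2) * (n / 4) 
      + d / (2 * a * n ^ 4) * (3 * n ^ 2 / 16)))) = 7 / 192 * L * d ^ 2 * a := by
    have : (d:ℝ) / (2 * a * n ^ 4) = a / (2 * n ^ 3) := by
      have hd' : (d:ℝ) = a ^ 2 * n := by rw [ha2]; field_simp
      rw [hd']; field_simp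
    rw [this]; field_simp; ring
  have ha3 : (d:ℝ) ^ 2 * a = (d:ℝ) ^ ((5:ℝ)/2) * (n:ℝ) ^ (-(1:ℝ)/2) := by
    rw [ha, Real.sqrt_eq_rpow, Real.div_rpow hd0.le hn0.le, neg_div, Real.rpow_neg hn0.le,
      div_eq_mul_inv, ← mul_assoc, ← Real.rpow_natCast, ← Real.rpow_add hd0]
    norm_num
  have h3 : (3:ℝ) ^ ((1:ℝ)/4) ≤ 12 / 7 := by
    have : (12/7:ℝ) = ((12/7:ℝ) ^ (4:ℝ)) ^ ((1:ℝ)/4) := by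
      rw [← Real.rpow_mul (by norm_num)]; norm_num
    rw [this]
    exact Real.rpow_le_rpow (by norm_num) (by norm_num) (by norm_num)
  have h3p : (0:ℝ) < (3:ℝ) ^ ((1:ℝ)/4) := by positivity
  have hconst : (7:ℝ)/192 ≤ 1 / (16 * (3:ℝ) ^ ((1:ℝ)/4)) := by
    rw [le_div_iff₀ (by positivity)]; linarith
  calc (n:ℝ) * |Ex x n R| ≤ n * _ := mul_le_mul_of_nonneg_left (hER.trans hEQ) hn0.le
    _ = 7 / 192 * (L * (d ^ 2 * a)) := by rw [hfin]; ring
    _ ≤ 1 / (16 * (3:ℝ) ^ ((1:ℝ)/4)) * (L * (d ^ 2 * a)) := by gcongr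
    _ = _ := by rw [ha3]; ring
end
end

section
/- For every integer d ≥ 2 and every positive integer β, there exists a constant C > 0, depending only on d and β, such that for every n ∈ ℕ, every x ∈ Δ_{d−1}, and all integers 0 ≤ k ≤ ℓ, the Markov chain with multinomial transitions started at x satisfies 𝔼[‖H_n^ℓ(x) − H_n^k(x)‖^{2β}] ≤ C·((ℓ − k)/n)^β, where ‖·‖ is the Euclidean norm on ℝ^d. -/
open Finset Filter MeasureTheory

noncomputable section

lemma aux_mgf {d : ℕ} (n : ℕ) (x z : Fin d → ℝ) :
    ∑ k ∈ multiIdx d n, mWeight x k * ∏ j, z j ^ k j = (∑ j, x j * z j) ^ n := by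
  have hs : multiIdx d n = Finset.piAntidiag Finset.univ n := by
    ext k
    simp only [multiIdx, Finset.mem_filter, Fintype.mem_piFinset, Finset.mem_range,
      Finset.mem_piAntidiag, Finset.mem_univ, implies_true, and_true, and_iff_right_iff_imp]
    intro h i
    have := Finset.single_le_sum (f := k) (fun _ _ => Nat.zero_le _) (Finset.mem_univ i)
    omega
  rw [Finset.sum_pow_eq_sum_piAntidiag, hs]
  refine Finset.sum_congr rfl fun k _ => ?_
  simp only [mWeight, mul_pow, Finset.prod_mul_distrib]
  ring

lemma aux_step {d : ℕ} (n : ℕ) (hn : 1 ≤ n) (x : Fin d → ℝ) (hx : x ∈ stdSimplex ℝ (Fin d))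
    (i : Fin d) (t : ℝ) (ht : |t| ≤ n) :
    ∑ k ∈ multiIdx d n, mWeight x k * Real.exp (t * ((k i : ℝ) / n))
      ≤ Real.exp (t * x i + t ^ 2 / n) := by
  have hn' : (0 : ℝ) < n := by exact_mod_cast hn
  have hx0 : 0 ≤ x i := hx.1 i
  have hx1 : x i ≤ 1 := by
    rw [← hx.2]; exact Finset.single_le_sum (fun j _ => hx.1 j) (Finset.mem_univ i)
  set s : ℝ := t / n with hsdef
  have hs : |s| ≤ 1 := by
    rw [hsdef, abs_div, abs_of_pos hn', div_le_one hn']; exact ht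
  have h1 := aux_mgf n x (fun j => if j = i then Real.exp s else 1)
  have h2 : ∑ k ∈ multiIdx d n, mWeight x k * Real.exp (t * ((k i : ℝ) / n))
      = (∑ j, x j * (if j = i then Real.exp s else 1)) ^ n := by
    rw [← h1]
    refine Finset.sum_congr rfl fun k _ => ?_
    congr 1
    rw [Finset.prod_eq_single i]
    · rw [if_pos rfl, ← Real.exp_nat_mul]
      congr 1
      rw [hsdef]; ring
    · intro j _ hj
      simp [hj]
    · simp
  have h3 : ∑ j, x j * (if j = i then Real.exp s else 1) = 1 + x i * (Real.exp s - 1) := by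
    have : ∀ j, x j * (if j = i then Real.exp s else 1)
        = x j + (if j = i then x j * (Real.exp s - 1) else 0) := by
      intro j; split_ifs <;> ring
    simp only [this, Finset.sum_add_distrib, hx.2, Finset.sum_ite_eq', Finset.mem_univ, if_true]
  have h4 := (abs_le.mp (Real.abs_exp_sub_one_sub_id_le hs)).2
  have h5 : 1 + x i * (Real.exp s - 1) ≤ Real.exp (x i * s + s ^ 2) := by
    have := Real.add_one_le_exp (x i * s + s ^ 2)
    nlinarith [sq_nonneg s, mul_le_mul_of_nonneg_left h4 hx0]
  have h6 : 0 ≤ 1 + x i * (Real.exp s - 1) := by nlinarith [Real.exp_pos s]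
  rw [h2, h3]
  refine (pow_le_pow_left₀ h6 h5 n).trans (le_of_eq ?_)
  rw [← Real.exp_nat_mul]
  congr 1
  rw [hsdef]; field_simp

lemma aux_int {d : ℕ} {Ω : Type} {m : MeasurableSpace Ω} (μ : Measure Ω)
    [IsProbabilityMeasure μ] (H : ℕ → Ω → (Fin d → ℝ)) (hm : ∀ N, Measurable (H N))
    (hH : ∀ N ω, H N ω ∈ stdSimplex ℝ (Fin d)) (i : Fin d) (a b : ℝ) (k l : ℕ) :
    Integrable (fun ω => Real.exp (a * H l ω i + b * H k ω i)) μ := by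
  have hmi : ∀ N, Measurable fun ω => H N ω i := fun N => (measurable_pi_apply i).comp (hm N)
  refine Integrable.of_bound (C := Real.exp (|a| + |b|)) ?_ (ae_of_all _ fun ω => ?_)
  · exact (Real.measurable_exp.comp
      (((hmi l).const_mul a).add ((hmi k).const_mul b))).aestronglyMeasurable
  · have hb : ∀ N, |H N ω i| ≤ 1 := by
      intro N
      rw [abs_of_nonneg ((hH N ω).1 i), ← (hH N ω).2]
      exact Finset.single_le_sum (fun j _ => (hH N ω).1 j) (Finset.mem_univ i)
    rw [Real.norm_eq_abs, Real.abs_exp, Real.exp_le_exp]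
    have h1 : a * H l ω i ≤ |a| := (le_abs_self _).trans (by
      rw [abs_mul]; exact mul_le_of_le_one_right (abs_nonneg _) (hb l))
    have h2 : b * H k ω i ≤ |b| := (le_abs_self _).trans (by
      rw [abs_mul]; exact mul_le_of_le_one_right (abs_nonneg _) (hb k))
    linarith

lemma aux_exp {d : ℕ} (n : ℕ) (hn : 1 ≤ n)
    {Ω : Type} {m : MeasurableSpace Ω} (μ : Measure Ω) [IsProbabilityMeasure μ]
    (ℱ : Filtration ℕ m) (H : ℕ → Ω → (Fin d → ℝ)) (hA : Adapted ℱ H)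
    (hH : ∀ N ω, H N ω ∈ stdSimplex ℝ (Fin d))
    (hc : ∀ (N : ℕ) (g : (Fin d → ℝ) → ℝ),
          μ[(fun ω => g (H (N + 1) ω))|ℱ N]
            =ᵐ[μ] fun ω => ∑ k ∈ multiIdx d n, mWeight (H N ω) k * g fun i => (k i : ℝ) / n)
    (i : Fin d) (t : ℝ) (ht : |t| ≤ n) (k N : ℕ) :
    ∫ ω, Real.exp (t * H (k + N) ω i + (-t) * H k ω i) ∂μ ≤ Real.exp (t ^ 2 / n * N) := by
  have hm : ∀ N, Measurable (H N) := fun N => hA.measurable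
  induction N with
  | zero => simp
  | succ N ih =>
    have hint := aux_int μ H hm hH i t (-t) k (k + N)
    have hint1 := aux_int μ H hm hH i t (-t) k (k + N + 1)
    have hint2 := aux_int μ H hm hH i t 0 k (k + N + 1)
    set f : Ω → ℝ := fun ω => Real.exp ((-t) * H k ω i) with hf
    set g : Ω → ℝ := fun ω => Real.exp (t * H (k + N + 1) ω i) with hg
    have hfg : f * g = fun ω => Real.exp (t * H (k + N + 1) ω i + (-t) * H k ω i) := by
      ext ω; simp only [Pi.mul_apply, hf, hg]; rw [← Real.exp_add, add_comm]
    have hfm : StronglyMeasurable[ℱ (k + N)] f := by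
      have h0 : Measurable[ℱ (k + N)] (H k) := hA.measurable_le (Nat.le_add_right k N)
      have h1 : Measurable[ℱ (k + N)] f :=
        Real.measurable_exp.comp (((measurable_pi_apply i).comp h0).const_mul (-t))
      exact h1.stronglyMeasurable
    have hgi : Integrable g μ := by simpa [hg] using hint2
    have hpull := condExp_mul_of_stronglyMeasurable_left (μ := μ) hfm (by rw [hfg]; exact hint1) hgi
    have hcg := hc (k + N) (fun y => Real.exp (t * y i))
    have e1 : ∫ ω, Real.exp (t * H (k + N + 1) ω i + (-t) * H k ω i) ∂μ
        = ∫ ω, (μ[f * g|ℱ (k + N)]) ω ∂μ := by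
      rw [integral_condExp (ℱ.le _), hfg]
    have e2 : (μ[f * g|ℱ (k + N)]) ≤ᵐ[μ] fun ω =>
        Real.exp (t ^ 2 / n) * Real.exp (t * H (k + N) ω i + (-t) * H k ω i) := by
      filter_upwards [hpull, hcg] with ω h1 h2
      rw [h1, Pi.mul_apply, h2]
      have := aux_step n hn (H (k + N) ω) (hH _ ω) i t ht
      calc _ ≤ f ω * Real.exp (t * H (k + N) ω i + t ^ 2 / n) :=
            mul_le_mul_of_nonneg_left this (Real.exp_pos _).le
        _ = _ := by
            simp only [hf]
            rw [← Real.exp_add, ← Real.exp_add]; congr 1; ring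
    rw [← add_assoc, e1]
    calc _ ≤ ∫ ω, Real.exp (t ^ 2 / n) * Real.exp (t * H (k + N) ω i + (-t) * H k ω i) ∂μ :=
          integral_mono_ae integrable_condExp (hint.const_mul _) e2
      _ = Real.exp (t ^ 2 / n) * ∫ ω, Real.exp (t * H (k + N) ω i + (-t) * H k ω i) ∂μ :=
          integral_const_mul _ _
      _ ≤ Real.exp (t ^ 2 / n) * Real.exp (t ^ 2 / n * N) :=
          mul_le_mul_of_nonneg_left ih (Real.exp_pos _).le
      _ = _ := by rw [← Real.exp_add]; congr 1; push_cast; ring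

lemma aux_pow (β : ℕ) (u : ℝ) :
    u ^ (2 * β) ≤ (Nat.factorial (2 * β) : ℝ) * (Real.exp u + Real.exp (-u)) := by
  have h := Real.pow_div_factorial_le_exp |u| (abs_nonneg u) (2 * β)
  rw [div_le_iff₀ (by positivity), pow_mul, sq_abs, ← pow_mul] at h
  have h2 : Real.exp |u| ≤ Real.exp u + Real.exp (-u) := by
    rcases abs_cases u with ⟨h, _⟩ | ⟨h, _⟩ <;> rw [h] <;>
      linarith [Real.exp_pos u, Real.exp_pos (-u)]
  rw [mul_comm (Nat.factorial (2 * β) : ℝ)]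
  exact h.trans (mul_le_mul_of_nonneg_right h2 (by positivity))

lemma aux_euc {d : ℕ} (β : ℕ) (v : Fin d → ℝ) (hβ : 1 ≤ β) :
    eucNorm v ^ (2 * β) ≤ (d : ℝ) ^ (β - 1) * ∑ i, v i ^ (2 * β) := by
  obtain ⟨b, rfl⟩ : ∃ b, β = b + 1 := ⟨β - 1, by omega⟩
  have h := pow_sum_le_card_mul_sum_pow (s := Finset.univ) (f := fun i => v i ^ 2)
    (fun i _ => sq_nonneg _) b
  rw [eucNorm, pow_mul, Real.sq_sqrt (Finset.sum_nonneg fun i _ => sq_nonneg _)]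
  simpa [pow_mul] using h

/-- for every `d ≥ 2` and `β ≥ 1` there is a constant `C > 0`, depending
only on `d` and `β`, such that for every `n ≥ 1`, every `x ∈ Δ_{d−1}`, and every
realization of the Markov chain `{H_n^N(x)}_N` with multinomial transitions started at
`x`, one has `𝔼[‖H_n^ℓ(x) − H_n^k(x)‖^{2β}] ≤ C·((ℓ − k)/n)^β` for all `0 ≤ k ≤ ℓ`. -/
theorem multinomial_chain_increment_moment (d : ℕ) (hd : 2 ≤ d) (β : ℕ) (hβ : 1 ≤ β) :
    ∃ C : ℝ, 0 < C ∧
      ∀ (n : ℕ), 1 ≤ n → ∀ x ∈ stdSimplex ℝ (Fin d),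
      ∀ (Ω : Type) (m : MeasurableSpace Ω) (μ : Measure Ω),
        IsProbabilityMeasure μ →
      ∀ (ℱ : Filtration ℕ m) (H : ℕ → Ω → (Fin d → ℝ)),
        Adapted ℱ H →
        (∀ ω, H 0 ω = x) →
        (∀ N ω, H N ω ∈ stdSimplex ℝ (Fin d)) →
        (∀ (N : ℕ) (g : (Fin d → ℝ) → ℝ),
          μ[(fun ω => g (H (N + 1) ω))|ℱ N]
            =ᵐ[μ] fun ω => ∑ k ∈ multiIdx d n, mWeight (H N ω) k * g fun i => (k i : ℝ) / n) →
      ∀ k ℓ : ℕ, k ≤ ℓ →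
        ∫ ω, (eucNorm (H ℓ ω - H k ω)) ^ (2 * β) ∂μ
          ≤ C * (((ℓ : ℝ) - (k : ℝ)) / n) ^ β := by
  classical
  set F : ℝ := (Nat.factorial (2 * β) : ℝ) with hF
  have hFpos : 0 < F := by positivity
  have hdpos : (0 : ℝ) < d := by exact_mod_cast (by omega : 0 < d)
  refine ⟨(d : ℝ) ^ (β - 1) * (d * (F * (2 * Real.exp 1))), by positivity, ?_⟩
  intro n hn x _ Ω m μ hμ ℱ H hA _ hH hc k ℓ hkl
  obtain ⟨N, rfl⟩ := Nat.exists_eq_add_of_le hkl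
  have hn' : (0 : ℝ) < n := by exact_mod_cast hn
  have hm : ∀ N, Measurable (H N) := fun N => hA.measurable
  rcases Nat.eq_zero_or_pos N with rfl | hN
  · have : β ≠ 0 := by omega
    simp [eucNorm, this]
  have hN' : (0 : ℝ) < N := by exact_mod_cast hN
  have hcast : ((k + N : ℕ) : ℝ) - k = N := by push_cast; ring
  rw [hcast]
  set t : ℝ := Real.sqrt (n / N) with ht
  have ht2 : t ^ 2 = n / N := Real.sq_sqrt (by positivity)
  have htpos : 0 < t := Real.sqrt_pos.mpr (by positivity)
  have htn : t ≤ n := by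
    have h1 : (1 : ℝ) ≤ n := by exact_mod_cast hn
    have h2 : (1 : ℝ) ≤ N := by exact_mod_cast hN
    rw [ht, Real.sqrt_le_left hn'.le]
    calc (n : ℝ) / N ≤ n := div_le_self hn'.le h2
      _ ≤ n ^ 2 := by nlinarith
  have hexp1 : t ^ 2 / n * N = 1 := by rw [ht2]; field_simp
  set R : ℝ := ((N : ℝ) / n) ^ β with hR
  have hRpos : 0 < R := by positivity
  have htR : R * t ^ (2 * β) = 1 := by
    rw [pow_mul, ht2, hR, ← mul_pow]
    rw [show (N : ℝ) / n * (n / N) = 1 by field_simp, one_pow]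
  let E : Fin d → Ω → ℝ := fun i ω => Real.exp (t * H (k + N) ω i + (-t) * H k ω i)
    + Real.exp ((-t) * H (k + N) ω i + (-(-t)) * H k ω i)
  have hEint : ∀ i, Integrable (E i) μ := fun i =>
    (aux_int μ H hm hH i t (-t) k (k + N)).add (aux_int μ H hm hH i (-t) (-(-t)) k (k + N))
  have hE : ∀ i, ∫ ω, E i ω ∂μ ≤ 2 * Real.exp 1 := by
    intro i
    have h1 := aux_exp n hn μ ℱ H hA hH hc i t (by rwa [abs_of_pos htpos]) k N
    have h2 := aux_exp n hn μ ℱ H hA hH hc i (-t) (by rwa [abs_neg, abs_of_pos htpos]) k N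
    rw [neg_sq] at h2
    rw [hexp1] at h1 h2
    have h3 : ∫ ω, E i ω ∂μ = _ := integral_add (aux_int μ H hm hH i t (-t) k (k + N))
      (aux_int μ H hm hH i (-t) (-(-t)) k (k + N))
    rw [h3]; linarith
  have hpt : ∀ ω, eucNorm (H (k + N) ω - H k ω) ^ (2 * β)
      ≤ (d : ℝ) ^ (β - 1) * ∑ i, R * (F * E i ω) := by
    intro ω
    refine (aux_euc β _ hβ).trans (mul_le_mul_of_nonneg_left ?_ (by positivity))
    refine Finset.sum_le_sum fun i _ => ?_
    have h := aux_pow β (t * (H (k + N) ω i - H k ω i))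
    have h' := mul_le_mul_of_nonneg_left h hRpos.le
    rw [mul_pow, ← mul_assoc, htR, one_mul] at h'
    refine h'.trans (le_of_eq ?_)
    simp only [E]
    congr 4 <;> ring
  have hsint : Integrable (fun ω => (d : ℝ) ^ (β - 1) * ∑ i, R * (F * E i ω)) μ :=
    (integrable_finsetSum _ fun i _ => ((hEint i).const_mul F).const_mul R).const_mul _
  calc _ ≤ ∫ ω, (d : ℝ) ^ (β - 1) * ∑ i, R * (F * E i ω) ∂μ :=
        integral_mono_of_nonneg (ae_of_all _ fun ω => pow_nonneg (Real.sqrt_nonneg _) _) hsint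
          (ae_of_all _ hpt)
    _ = (d : ℝ) ^ (β - 1) * ∑ i, R * (F * ∫ ω, E i ω ∂μ) := by
        rw [integral_const_mul, integral_finsetSum _
          fun i _ => ((hEint i).const_mul F).const_mul R]
        simp only [integral_const_mul]
    _ ≤ (d : ℝ) ^ (β - 1) * ∑ _i : Fin d, R * (F * (2 * Real.exp 1)) := by
        gcongr with i _
        exact hE i
    _ = _ := by simp; ring
end
end
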